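/- Let N ≥ 1, let A, C ∈ ℂ^{N×N}, and let X : [0,∞) → ℂ^{N×N} be a differentiable curve with X(0) = A satisfying the double-bracket flow X'(t) = [X(t), ([X(t), C†])_S] for all t ≥ 0. Then the flow is isospectral: for every t ≥ 0 there is a unitary matrix U(t) with X(t) = U(t) A U(t)†, so X(t) stays on the unitary orbit of A; moreover t ↦ Re tr(C† X(t)) is nondecreasing, and X(t) converges as t → +∞ to a matrix X∞ satisfying ([X∞, C†])_S = 0. -/

import Mathlib

open Matrix Filter Topology

attribute [local instance] Matrix.normedAddCommGroup Matrix.normedSpace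

/-- The skew-Hermitian part `M_S = (M − M†)/2` of a square complex matrix. -/
noncomputable def skewPart {N : ℕ} (M : Matrix (Fin N) (Fin N) ℂ) :
    Matrix (Fin N) (Fin N) ℂ :=
  ((1 : ℂ) / 2) • (M - Mᴴ)

open Polynomial TensorProduct in
/-- In characteristic zero a transcendental element has a derivation taking the value one on it. -/
theorem exists_derivation_eq_one {k K : Type*} [Field k] [Field K] [CharZero k] [Algebra k K]
    [Algebra.EssFiniteType k K] {t : K} (ht : Transcendental k t) :
    ∃ D : Derivation k K K, D t = 1 := by
  let i : k[X] →ₐ[k] K := aeval t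
  have hi : Function.Injective i := transcendental_iff_injective.mp ht
  let : Algebra k[X] K := i.toRingHom.toAlgebra
  have hiX : algebraMap k[X] K X = t := aeval_X t
  have : IsScalarTower k k[X] K := .of_algebraMap_eq fun x => (i.commutes x).symm
  have : FaithfulSMul k[X] K := (faithfulSMul_iff_algebraMap_injective _ _).mpr hi
  let : Algebra (FractionRing k[X]) K := FractionRing.liftAlgebra k[X] K
  have : IsScalarTower k (FractionRing k[X]) K := .of_algebraMap_eq fun x => by
    rw [IsScalarTower.algebraMap_apply k k[X] K, IsScalarTower.algebraMap_apply k k[X]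
      (FractionRing k[X]), ← IsScalarTower.algebraMap_apply k[X] (FractionRing k[X]) K]
  have : Algebra.EssFiniteType (FractionRing k[X]) K := .of_comp k _ K
  have : CharZero (FractionRing k[X]) :=
    charZero_of_injective_algebraMap (algebraMap k (FractionRing k[X])).injective
  have : Algebra.FormallySmooth k[X] (FractionRing k[X]) :=
    .of_isLocalization (nonZeroDivisors k[X])
  have : Algebra.FormallySmooth k[X] K := .comp _ (FractionRing k[X]) _
  have hinj : Function.Injective (KaehlerDifferential.mapBaseChange k k[X] K) := by
    rw [injective_iff_map_eq_zero]
    intro x hx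
    obtain ⟨y, rfl⟩ := (Algebra.H1Cotangent.exact_δ_mapBaseChange k k[X] K x).mp hx
    rw [Subsingleton.elim y 0, map_zero]
  have hne : KaehlerDifferential.D k K t ≠ 0 := by
    intro h0
    have h3 : (1 : K) ⊗ₜ[k[X]] KaehlerDifferential.D k k[X] X = 0 :=
      hinj (by simp [hiX, h0])
    have h4 := congrArg (LinearMap.lTensor K (KaehlerDifferential.polynomialEquiv k).toLinearMap) h3
    have h5 := congrArg (TensorProduct.rid k[X] K) h4
    simp at h5
  obtain ⟨l, hl⟩ := Module.Projective.exists_dual_ne_zero K hne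
  refine ⟨(l (KaehlerDifferential.D k K t))⁻¹ • l.compDer (KaehlerDifferential.D k K), ?_⟩
  simp [hl]

/-- In characteristic zero, an element killed by all derivations is algebraic. -/
theorem isAlgebraic_of_forall_derivation_eq_zero {k K : Type*} [Field k] [Field K] [CharZero k]
    [Algebra k K] [Algebra.EssFiniteType k K] {t : K} (ht : ∀ D : Derivation k K K, D t = 0) :
    IsAlgebraic k t := by
  by_contra h
  obtain ⟨D, hD⟩ := exists_derivation_eq_one h
  simp [ht D] at hD

/-- A local algebra over a field `k` contains an extension field of `k` over which its residue
field is algebraic. -/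
theorem IsLocalRing.exists_field_isAlgebraic_residueField {k O : Type} [Field k] [CommRing O]
    [IsLocalRing O] [Algebra k O] :
    ∃ (F : Type) (_ : Field F) (_ : Algebra k F) (_ : Algebra F O), IsScalarTower k F O ∧
      Algebra.IsAlgebraic F (ResidueField O) := by
  obtain ⟨ι, s, hs⟩ := exists_isTranscendenceBasis' k (ResidueField O)
  choose y hy using fun i => residue_surjective (s i)
  let φ : MvPolynomial ι k →ₐ[k] O := MvPolynomial.aeval y
  have hφ : ∀ p, residue O (φ p) = MvPolynomial.aeval s p := fun p => by
    have : (IsScalarTower.toAlgHom k O (ResidueField O)).comp φ = MvPolynomial.aeval s := by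
      ext i
      simp [φ, ← hy]
    exact DFunLike.congr_fun this p
  have hunit : ∀ p : nonZeroDivisors (MvPolynomial ι k), IsUnit (φ p) := fun p => by
    rw [← residue_ne_zero_iff_isUnit, hφ]
    exact (map_ne_zero_iff _ hs.1).mpr (nonZeroDivisors.ne_zero p.2)
  let ψ : FractionRing (MvPolynomial ι k) →+* O := IsLocalization.lift (g := φ.toRingHom) hunit
  have hψ : ∀ p, ψ (algebraMap _ _ p) = φ p := IsLocalization.lift_eq hunit
  let : Algebra (FractionRing (MvPolynomial ι k)) O := ψ.toAlgebra
  have : IsScalarTower k (FractionRing (MvPolynomial ι k)) O := .of_algebraMap_eq fun x => by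
    rw [IsScalarTower.algebraMap_apply k (MvPolynomial ι k) (FractionRing (MvPolynomial ι k))]
    exact (φ.commutes x).symm.trans (hψ _).symm
  refine ⟨FractionRing (MvPolynomial ι k), inferInstance, inferInstance, inferInstance, this, ?_⟩
  have halg := hs.isAlgebraic
  let e := hs.1.aevalEquiv
  have hcomp : ∀ z : Algebra.adjoin k (Set.range s),
      algebraMap (FractionRing (MvPolynomial ι k)) (ResidueField O)
        (algebraMap _ _ (e.symm z)) = z := fun z => by
    have h1 : (MvPolynomial.aeval s (e.symm z) : ResidueField O) = z := by
      rw [← hs.1.algebraMap_aevalEquiv]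
      simp [e]
    rw [← h1, ← hφ, ← hψ]
    rfl
  constructor
  intro x
  obtain ⟨P, hP0, hP⟩ := halg.isAlgebraic x
  let h : Algebra.adjoin k (Set.range s) →+* FractionRing (MvPolynomial ι k) :=
    (algebraMap _ _).comp e.symm.toRingHom
  have hinj : Function.Injective h := (IsFractionRing.injective _ _).comp e.symm.injective
  refine ⟨P.map h, (Polynomial.map_ne_zero_iff hinj).mpr hP0, ?_⟩
  rw [Polynomial.aeval_def, Polynomial.eval₂_map, ← hP, Polynomial.aeval_def]
  congr 1
  ext z
  exact hcomp z

/-- If `F` is a subfield of a local domain `O` over which the residue field is algebraic, then a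
derivation of the fraction field which kills `F` and maps some uniformizer into `O` maps `O`
into itself. -/
theorem Derivation.mem_range_of_isAlgebraic_residueField {F O K : Type} [Field F] [CommRing O]
    [IsDomain O] [IsLocalRing O] [Algebra F O] [Algebra.EssFiniteType F O] [CharZero F]
    [Algebra.IsAlgebraic F (IsLocalRing.ResidueField O)]
    [Field K] [Algebra O K] [Algebra F K] [IsScalarTower F O K]
    {t : O} (ht : IsLocalRing.maximalIdeal O = Ideal.span {t})
    (D : Derivation F K K) (hDt : D (algebraMap O K t) = 1) (a : O) :
    ∃ b : O, algebraMap O K b = D (algebraMap O K a) := by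
  let D' : Derivation F O K := D.compAlgebraMap O
  let N : Submodule O K := LinearMap.range D'.liftKaehlerDifferential
  let N₀ : Submodule O K := LinearMap.range (Algebra.linearMap O K)
  have hN : N.FG := by
    rw [show N = Submodule.map D'.liftKaehlerDifferential ⊤ from LinearMap.range_eq_map _]
    exact Submodule.FG.map _ Module.Finite.fg_top
  have hD' : ∀ x, D' x = D (algebraMap O K x) := fun x => rfl
  have hmem : ∀ x, D' x ∈ N := fun x => ⟨KaehlerDifferential.D F O x, by simp⟩
  have key : N ≤ N₀ ⊔ IsLocalRing.maximalIdeal O • N := by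
    have hNs : N = Submodule.span O (D'.liftKaehlerDifferential ''
        Set.range (KaehlerDifferential.D F O)) := by
      rw [← Submodule.map_span, KaehlerDifferential.span_range_derivation]
      exact LinearMap.range_eq_map _
    refine hNs.le.trans (Submodule.span_le.mpr ?_)
    rintro _ ⟨_, ⟨x, rfl⟩, rfl⟩
    rw [Derivation.liftKaehlerDifferential_comp_D, SetLike.mem_coe]
    have hx : IsIntegral F (IsLocalRing.residue O x) :=
      (Algebra.IsAlgebraic.isAlgebraic _).isIntegral
    let P := minpoly F (IsLocalRing.residue O x)
    have hres : ∀ Q : Polynomial F, IsLocalRing.residue O (Polynomial.aeval x Q) =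
        Polynomial.aeval (IsLocalRing.residue O x) Q := fun Q =>
      (Polynomial.aeval_algebraMap_apply (IsLocalRing.ResidueField O) x Q).symm
    have hP : Polynomial.aeval x P ∈ IsLocalRing.maximalIdeal O := by
      rw [← IsLocalRing.residue_eq_zero_iff, hres, minpoly.aeval]
    have hP' : IsUnit (Polynomial.aeval x P.derivative) := by
      rw [← IsLocalRing.residue_ne_zero_iff_isUnit, hres]
      exact (minpoly.irreducible hx).separable.aeval_derivative_ne_zero (minpoly.aeval _ _)
    rw [ht, Ideal.mem_span_singleton] at hP
    obtain ⟨b, hb⟩ := hP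
    obtain ⟨u, hu⟩ := hP'
    have h1 : D' (Polynomial.aeval x P) = Polynomial.aeval x P.derivative • D' x :=
      D'.map_aeval P x
    have h2 : D' (Polynomial.aeval x P) = algebraMap O K b + t • D' b := by
      rw [hb, Derivation.leibniz, hD' t, hDt, Algebra.smul_def b, mul_one, add_comm]
    have h3 : D' x = (↑u⁻¹ : O) • (algebraMap O K b + t • D' b) := by
      rw [← h2, h1, ← hu, smul_smul, Units.inv_mul, one_smul]
    rw [h3]
    refine Submodule.smul_mem _ _ (Submodule.add_mem_sup ⟨b, rfl⟩ ?_)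
    refine Submodule.smul_mem_smul ?_ (hmem b)
    rw [ht]
    exact Ideal.mem_span_singleton_self t
  have hle : N ≤ N₀ := Submodule.le_of_le_smul_of_le_jacobson_bot hN
      (IsLocalRing.maximalIdeal_le_jacobson _) key
  exact hle (hmem a)

/-- In a discrete valuation ring of characteristic zero, if `g` divides every derivative of a
nonunit `f`, then `g` divides `f` with quotient a nonunit. -/
theorem exists_eq_mul_of_forall_derivation_dvd {k O : Type} [Field k] [CharZero k] [CommRing O]
    [IsDomain O] [IsDiscreteValuationRing O] [Algebra k O] [Algebra.EssFiniteType k O]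
    {f g : O} (hf : f ∈ IsLocalRing.maximalIdeal O) (h : ∀ D : Derivation k O O, g ∣ D f) :
    ∃ w ∈ IsLocalRing.maximalIdeal O, f = g * w := by
  obtain ⟨F, _, _, _, _, _⟩ := IsLocalRing.exists_field_isAlgebraic_residueField (k := k) (O := O)
  obtain ⟨t, hirr⟩ := IsDiscreteValuationRing.exists_irreducible O
  have ht := hirr.maximalIdeal_eq
  let K := FractionRing O
  have : CharZero F := charZero_of_injective_algebraMap (algebraMap k F).injective
  have : Algebra.EssFiniteType F O := .of_comp k F O
  have : Algebra.EssFiniteType O K := .of_isLocalization K (nonZeroDivisors O)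
  have : Algebra.EssFiniteType F K := .comp F O K
  have htr : Transcendental F (algebraMap O K t) := by
    intro halg
    let A : Subalgebra F K := (IsScalarTower.toAlgHom F O K).range
    obtain ⟨b, hb⟩ := A.inv_mem_of_algebraic (x := ⟨algebraMap O K t, t, rfl⟩) halg
    refine hirr.not_isUnit (IsUnit.of_mul_eq_one b (IsFractionRing.injective O K ?_))
    have h0 : algebraMap O K t ≠ 0 :=
      (map_ne_zero_iff _ (IsFractionRing.injective O K)).mpr hirr.ne_zero
    have hb' : algebraMap O K b = (algebraMap O K t)⁻¹ := hb
    rw [map_mul, hb', mul_inv_cancel₀ h0, map_one]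
  obtain ⟨D, hD⟩ := exists_derivation_eq_one htr
  choose δ hδ using D.mem_range_of_isAlgebraic_residueField ht hD
  have hinj := IsFractionRing.injective O K
  let D' : Derivation k O O :=
    { toFun := δ
      map_add' := fun x y => hinj (by simp [hδ])
      map_smul' := fun c x => hinj (by
        rw [hδ, RingHom.id_apply, Algebra.smul_def, Algebra.smul_def,
          IsScalarTower.algebraMap_apply k F O, RingHom.map_mul, RingHom.map_mul, hδ,
          ← IsScalarTower.algebraMap_apply F O K, D.leibniz, D.map_algebraMap, smul_zero,
          add_zero, smul_eq_mul])
      map_one_eq_zero' := hinj (by simp [hδ])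
      leibniz' := fun x y => hinj (by simp [hδ]) }
  have hD't : D' t = 1 := hinj (by rw [map_one, ← hD]; exact hδ t)
  obtain rfl | hf0 := eq_or_ne f 0
  · exact ⟨0, zero_mem _, by simp⟩
  obtain ⟨n, u, rfl⟩ := IsDiscreteValuationRing.eq_unit_mul_pow_irreducible hf0 hirr
  obtain _ | m := n
  · simp at hf
  have htm : t ∈ IsLocalRing.maximalIdeal O := ht ▸ Ideal.mem_span_singleton_self t
  have hunit : IsUnit (((m + 1 : ℕ) : O) * u + t * D' u) := by
    by_contra hn
    have h1 : ((m + 1 : ℕ) : O) * u ∈ IsLocalRing.maximalIdeal O := by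
      have := sub_mem ((IsLocalRing.mem_maximalIdeal _).mpr hn) (Ideal.mul_mem_right (D' u) _ htm)
      simpa using this
    refine (IsLocalRing.mem_maximalIdeal _).mp h1 (IsUnit.mul ?_ u.isUnit)
    have : ((m + 1 : ℕ) : O) = algebraMap k O ((m + 1 : ℕ) : k) := by simp
    rw [this]
    exact (IsUnit.mk0 _ (Nat.cast_ne_zero.mpr m.succ_ne_zero)).map _
  obtain ⟨v, hv⟩ := hunit
  have hDf : D' (↑u * t ^ (m + 1)) = t ^ m * v := by
    rw [hv, D'.leibniz, D'.leibniz_pow, hD't]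
    simp only [smul_eq_mul, nsmul_eq_mul, Nat.add_sub_cancel]
    ring
  obtain ⟨c, hc⟩ := h D'
  rw [hDf] at hc
  have hc' : t ^ m = g * (c * ↑v⁻¹) := by
    rw [← mul_assoc, ← hc, mul_assoc, Units.mul_inv, mul_one]
  refine ⟨c * ↑v⁻¹ * u * t, Ideal.mul_mem_left _ _ htm, ?_⟩
  rw [pow_succ, hc']
  ring

/-- In an integrally closed Noetherian local domain whose maximal ideal is of the form `(g : b)`
with `g ≠ 0`, the maximal ideal is principal. -/
theorem IsLocalRing.maximalIdeal_isPrincipal_of_mem_iff_dvd {O : Type*} [CommRing O] [IsDomain O]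
    [IsLocalRing O] [IsNoetherianRing O] [IsIntegrallyClosed O] {g b : O} (hg : g ≠ 0)
    (h : ∀ x, x ∈ maximalIdeal O ↔ g ∣ x * b) : (maximalIdeal O).IsPrincipal := by
  by_cases hc : ∃ x ∈ maximalIdeal O, ∃ u : Oˣ, x * b = g * u
  · obtain ⟨x, hx, u, hu⟩ := hc
    refine ⟨x, le_antisymm (fun y hy => ?_) ?_⟩
    · obtain ⟨c, hc⟩ := (h y).mp hy
      refine Ideal.mem_span_singleton.mpr ⟨c * ↑u⁻¹, mul_left_cancel₀ hg ?_⟩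
      linear_combination (-(g * y)) * u.mul_inv - y * ↑u⁻¹ * hu + x * ↑u⁻¹ * hc
    · exact (Ideal.span_singleton_le_iff_mem _).mpr hx
  · exfalso
    push Not at hc
    have hg1 : g ∈ maximalIdeal O := (h g).mpr (dvd_mul_right g b)
    let K := FractionRing O
    have hinj := IsFractionRing.injective O K
    have hgK : algebraMap O K g ≠ 0 := (map_ne_zero_iff _ hinj).mpr hg
    let z : K := algebraMap O K b / algebraMap O K g
    have hz : IsIntegral O z := by
      refine isIntegral_of_smul_mem_submodule (M := K)
        (Submodule.map (Algebra.linearMap O K) (maximalIdeal O)) ?_ ?_ z ?_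
      · intro h0
        have : algebraMap O K g ∈ Submodule.map (Algebra.linearMap O K) (maximalIdeal O) :=
          ⟨g, hg1, rfl⟩
        rw [h0] at this
        exact hgK this
      · exact Submodule.FG.map _ (IsNoetherian.noetherian _)
      · rintro _ ⟨x, hx, rfl⟩
        obtain ⟨c, hxc⟩ := (h x).mp hx
        refine ⟨c, ?_, ?_⟩
        · by_contra hcm
          obtain ⟨u, rfl⟩ : IsUnit c := by simpa using hcm
          exact hc x hx u hxc
        · simp only [Algebra.linearMap_apply, smul_eq_mul, z]
          rw [div_mul_eq_mul_div, eq_div_iff hgK, ← map_mul, ← map_mul, mul_comm c, ← hxc,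
            mul_comm]
    obtain ⟨y, hy⟩ := IsIntegrallyClosed.isIntegral_iff.mp hz
    have hby : b = g * y := hinj (by
      rw [map_mul, hy, mul_div_cancel₀ _ hgK])
    have : (1 : O) ∈ maximalIdeal O := (h 1).mpr ⟨y, by rw [one_mul, hby]⟩
    exact (Ideal.ne_top_iff_one _).mp (maximalIdeal.isMaximal O).ne_top this

theorem mem_associatedPrimes_quotient_span_singleton_iff {B : Type*} [CommRing B]
    [IsNoetherianRing B] {g : B} {p : Ideal B} :
    p ∈ associatedPrimes B (B ⧸ Ideal.span {g}) ↔
      p.IsPrime ∧ ∃ b : B, ∀ x, x ∈ p ↔ g ∣ x * b := by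
  rw [AssociatedPrimes.mem_iff, isAssociatedPrime_iff]
  refine and_congr_right fun _ => ?_
  rw [(Ideal.Quotient.mk_surjective (I := Ideal.span {g})).exists]
  refine exists_congr fun b => ?_
  rw [SetLike.ext_iff]
  refine forall_congr' fun x => iff_congr Iff.rfl ?_
  rw [Submodule.mem_colon_singleton, Submodule.mem_bot, ← Ideal.mem_span_singleton,
    ← Ideal.Quotient.eq_zero_iff_mem]
  rfl

/-- The localization of an integrally closed Noetherian domain at an associated prime of a nonzero
principal ideal is a discrete valuation ring. -/
theorem isDiscreteValuationRing_of_mem_associatedPrimes {B : Type*} [CommRing B] [IsDomain B]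
    [IsNoetherianRing B] [IsIntegrallyClosed B] {g : B} (hg : g ≠ 0) {p : Ideal B} [p.IsPrime]
    (hp : p ∈ associatedPrimes B (B ⧸ Ideal.span {g})) :
    IsDiscreteValuationRing (Localization.AtPrime p) := by
  obtain ⟨-, b, hb⟩ := mem_associatedPrimes_quotient_span_singleton_iff.mp hp
  let O := Localization.AtPrime p
  have hinj : Function.Injective (algebraMap B O) :=
    IsLocalization.injective O p.primeCompl_le_nonZeroDivisors
  have hgO : algebraMap B O g ≠ 0 := (map_ne_zero_iff _ hinj).mpr hg
  have : IsNoetherianRing O := IsLocalization.isNoetherianRing p.primeCompl O inferInstance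
  have : IsIntegrallyClosed O :=
    isIntegrallyClosed_of_isLocalization _ p.primeCompl p.primeCompl_le_nonZeroDivisors
  have hmem : ∀ x, x ∈ IsLocalRing.maximalIdeal O ↔ algebraMap B O g ∣ x * algebraMap B O b := by
    intro x
    obtain ⟨y, s, rfl⟩ := IsLocalization.exists_mk'_eq p.primeCompl x
    rw [IsLocalization.AtPrime.mk'_mem_maximal_iff O p, hb]
    constructor
    · rintro ⟨c, hc⟩
      refine ⟨IsLocalization.mk' O c s, ?_⟩
      rw [mul_comm, IsLocalization.mul_mk'_eq_mk'_of_mul, IsLocalization.mul_mk'_eq_mk'_of_mul, ← hc, mul_comm]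
    · rintro ⟨z, hz⟩
      obtain ⟨c, r, rfl⟩ := IsLocalization.exists_mk'_eq p.primeCompl z
      rw [mul_comm, IsLocalization.mul_mk'_eq_mk'_of_mul, IsLocalization.mul_mk'_eq_mk'_of_mul,
        IsLocalization.mk'_eq_iff_eq, hinj.eq_iff] at hz
      have hry : (r : B) * y ∈ p := (hb _).mpr ⟨s * c, by linear_combination hz⟩
      exact (hb y).mp ((Ideal.IsPrime.mem_or_mem inferInstance hry).resolve_left r.2)
  have hprin := IsLocalRing.maximalIdeal_isPrincipal_of_mem_iff_dvd hgO hmem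
  have hnf : ¬ IsField O := by
    rw [IsLocalRing.isField_iff_maximalIdeal_eq]
    intro h0
    have : algebraMap B O g ∈ IsLocalRing.maximalIdeal O := (hmem _).mpr (dvd_mul_right _ _)
    rw [h0] at this
    exact hgO this
  exact ((IsDiscreteValuationRing.TFAE O hnf).out 0 4).mpr hprin

/-- If `g` divides the differential of `f`, then at an associated prime `p` of `(g)` some
`f - c` with `c` constant lies in `g • p`. -/
theorem exists_sub_algebraMap_eq_mul_of_mem_associatedPrimes {k B : Type} [Field k] [IsAlgClosed k]
    [CharZero k] [CommRing B] [IsDomain B] [IsIntegrallyClosed B] [Algebra k B]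
    [Algebra.FiniteType k B] {f g : B} (hg : g ≠ 0) {ω : Ω[B⁄k]}
    (hω : KaehlerDifferential.D k B f = g • ω) {p : Ideal B} [p.IsPrime]
    (hp : p ∈ associatedPrimes B (B ⧸ Ideal.span {g})) :
    ∃ c : k, ∃ w ∈ IsLocalRing.maximalIdeal (Localization.AtPrime p),
      algebraMap B (Localization.AtPrime p) (f - algebraMap k B c) =
        algebraMap B (Localization.AtPrime p) g * w := by
  have : IsNoetherianRing B := Algebra.FiniteType.isNoetherianRing k B
  have := isDiscreteValuationRing_of_mem_associatedPrimes hg hp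
  let O := Localization.AtPrime p
  let κ := IsLocalRing.ResidueField O
  have : Algebra.EssFiniteType B O := .of_isLocalization O p.primeCompl
  have : Algebra.EssFiniteType k O := .comp k B O
  have : Algebra.FiniteType O κ := .of_surjective (Algebra.ofId O κ) IsLocalRing.residue_surjective
  have : Algebra.EssFiniteType k κ := .comp k O κ
  have hgp : g ∈ p := by
    obtain ⟨-, b, hb⟩ := mem_associatedPrimes_quotient_span_singleton_iff.mp hp
    exact (hb g).mpr (dvd_mul_right g b)
  have hgO : algebraMap B O g ∈ IsLocalRing.maximalIdeal O :=
    (IsLocalization.AtPrime.to_map_mem_maximal_iff O p g).mpr hgp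
  have halg : IsAlgebraic k (algebraMap B κ f) := by
    refine isAlgebraic_of_forall_derivation_eq_zero fun D => ?_
    have h1 : D (algebraMap B κ f) = (D.compAlgebraMap B) f := rfl
    rw [h1, ← Derivation.liftKaehlerDifferential_comp_D, hω, map_smul, Algebra.smul_def,
      IsScalarTower.algebraMap_apply B O κ]
    have : algebraMap O κ (algebraMap B O g) = 0 := (IsLocalRing.residue_eq_zero_iff _).mpr hgO
    rw [this, zero_mul]
  obtain ⟨c, hc⟩ := minpoly.mem_range_of_degree_eq_one k (algebraMap B κ f)
    (IsAlgClosed.degree_eq_one_of_irreducible k (minpoly.irreducible halg.isIntegral))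
  have hmem : algebraMap B O (f - algebraMap k B c) ∈ IsLocalRing.maximalIdeal O := by
    rw [← IsLocalRing.residue_eq_zero_iff, ← IsLocalRing.ResidueField.algebraMap_eq,
      ← IsScalarTower.algebraMap_apply B O κ, map_sub, ← hc,
      ← IsScalarTower.algebraMap_apply k B κ, sub_self]
  obtain ⟨w, hw, h⟩ := exists_eq_mul_of_forall_derivation_dvd (k := k) (g := algebraMap B O g)
    hmem fun D => by
      have h1 : D (algebraMap B O (f - algebraMap k B c)) =
          (D.compAlgebraMap B) (f - algebraMap k B c) := rfl
      rw [h1, map_sub, Derivation.map_algebraMap, sub_zero,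
        ← Derivation.liftKaehlerDifferential_comp_D, hω, map_smul, Algebra.smul_def]
      exact dvd_mul_right _ _
  exact ⟨c, w, hw, h⟩

/-- In a normal domain of finite type over an algebraically closed field of characteristic zero,
if `g` divides the differential of `f`, then some product of distinct factors `f - c` is a
multiple of `g` by an element of the radical of `(g)`. -/
theorem exists_prod_sub_eq_mul_of_dvd_D {k B : Type} [Field k] [IsAlgClosed k]
    [CharZero k] [CommRing B] [IsDomain B] [IsIntegrallyClosed B] [Algebra k B]
    [Algebra.FiniteType k B] {f g : B} (hg : g ≠ 0) {ω : Ω[B⁄k]}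
    (hω : KaehlerDifferential.D k B f = g • ω) :
    ∃ (S : Finset k) (w : B) (n : ℕ),
      ∏ c ∈ S, (f - algebraMap k B c) = g * w ∧ g ∣ w ^ n := by
  classical
  have : IsNoetherianRing B := Algebra.FiniteType.isNoetherianRing k B
  have hfin : (associatedPrimes B (B ⧸ Ideal.span {g})).Finite := associatedPrimes.finite _ _
  have key : ∀ p : Ideal B, ∃ c : k, ∀ (hp : p ∈ associatedPrimes B (B ⧸ Ideal.span {g})),
      haveI := hp.isPrime
      ∃ w ∈ IsLocalRing.maximalIdeal (Localization.AtPrime p),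
      algebraMap B (Localization.AtPrime p) (f - algebraMap k B c) =
        algebraMap B (Localization.AtPrime p) g * w := fun p => by
    by_cases hp : p ∈ associatedPrimes B (B ⧸ Ideal.span {g})
    · have := hp.isPrime
      obtain ⟨c, hc⟩ := exists_sub_algebraMap_eq_mul_of_mem_associatedPrimes hg hω hp
      exact ⟨c, fun _ => hc⟩
    · exact ⟨0, fun h => absurd h hp⟩
  choose c hc using key
  let S := hfin.toFinset.image c
  let P := ∏ c ∈ S, (f - algebraMap k B c)
  have hP : ∀ p (hp : p ∈ associatedPrimes B (B ⧸ Ideal.span {g})),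
      haveI := hp.isPrime
      ∃ w ∈ IsLocalRing.maximalIdeal (Localization.AtPrime p),
      algebraMap B (Localization.AtPrime p) P = algebraMap B (Localization.AtPrime p) g * w := by
    intro p hp
    obtain ⟨w, hw, h⟩ := hc p hp
    have hS : c p ∈ S := Finset.mem_image_of_mem c (hfin.mem_toFinset.mpr hp)
    have := hp.isPrime
    refine ⟨w * algebraMap B _ (∏ c ∈ S.erase (c p), (f - algebraMap k B c)),
      Ideal.mul_mem_right _ _ hw, ?_⟩
    rw [← mul_assoc, ← h, ← map_mul, Finset.mul_prod_erase S (fun c => f - algebraMap k B c) hS]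
  have hdvd : g ∣ P := by
    by_contra hn
    have hne : Ideal.Quotient.mk (Ideal.span {g}) P ≠ 0 := by
      rwa [Ne, Ideal.Quotient.eq_zero_iff_mem, Ideal.mem_span_singleton]
    obtain ⟨p, hp, hle⟩ := exists_le_isAssociatedPrime_of_isNoetherianRing B _ hne
    have hpp := hp.isPrime
    obtain ⟨w, -, h⟩ := hP p hp
    obtain ⟨y, s, rfl⟩ := IsLocalization.exists_mk'_eq p.primeCompl w
    have hinj : Function.Injective (algebraMap B (Localization.AtPrime p)) :=
      IsLocalization.injective _ p.primeCompl_le_nonZeroDivisors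
    rw [IsLocalization.mul_mk'_eq_mk'_of_mul, eq_comm, IsLocalization.mk'_eq_iff_eq_mul,
      ← map_mul, hinj.eq_iff] at h
    refine s.2 (hle ?_)
    rw [Submodule.mem_colon_singleton, Submodule.mem_bot, ← Ideal.Quotient.mk_eq_mk,
      ← Submodule.Quotient.mk_smul, Submodule.Quotient.mk_eq_zero, Ideal.mem_span_singleton]
    exact ⟨y, by rw [h, smul_eq_mul, mul_comm]⟩
  obtain ⟨w, hw⟩ := hdvd
  have hrad : w ∈ (Ideal.span {g}).radical := by
    rw [Ideal.radical_eq_sInf, Submodule.mem_sInf]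
    intro J hJ
    obtain ⟨hJg, hJp⟩ := hJ
    obtain ⟨p, hp, hpJ⟩ := Ideal.exists_minimalPrimes_le hJg
    refine hpJ ?_
    have hpa : p ∈ associatedPrimes B (B ⧸ Ideal.span {g}) := by
      apply Module.associatedPrimes.minimalPrimes_annihilator_subset_associatedPrimes
      rwa [Ideal.annihilator_quotient]
    have hpp := hpa.isPrime
    obtain ⟨w', hw', h⟩ := hP p hpa
    have hinj : Function.Injective (algebraMap B (Localization.AtPrime p)) :=
      IsLocalization.injective _ p.primeCompl_le_nonZeroDivisors
    rw [hw, map_mul] at h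
    rw [← IsLocalization.AtPrime.to_map_mem_maximal_iff (Localization.AtPrime p) p w,
      mul_left_cancel₀ ((map_ne_zero_iff _ hinj).mpr hg) h]
    exact hw'
  obtain ⟨n, hn⟩ := hrad
  exact ⟨S, w, n, hw, Ideal.mem_span_singleton.mp hn⟩

/-- The normalization of a domain of finite type over a field of characteristic zero is of finite
type. -/
theorem finiteType_integralClosure_fractionRing (k A : Type*) [Field k] [CharZero k] [CommRing A]
    [IsDomain A] [Algebra k A] [Algebra.FiniteType k A] :
    Algebra.FiniteType k (integralClosure A (FractionRing A)) := by
  obtain ⟨s, g, hinj, hfin⟩ := exists_finite_inj_algHom_of_fg k A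
  let P := MvPolynomial (Fin s) k
  let K := FractionRing A
  let : Algebra P A := g.toRingHom.toAlgebra
  have : IsScalarTower k P A := .of_algebraMap_eq fun x => (g.commutes x).symm
  have : Module.Finite P A := hfin
  have : FaithfulSMul P A := (faithfulSMul_iff_algebraMap_injective _ _).mpr hinj
  have : FaithfulSMul P K := .trans P A K
  let : Algebra (FractionRing P) K := FractionRing.liftAlgebra P K
  have : Algebra.IsAlgebraic P A := inferInstance
  have : FiniteDimensional (FractionRing P) K := inferInstance
  have : CharZero (FractionRing P) :=
    charZero_of_injective_algebraMap (algebraMap k (FractionRing P)).injective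
  have : IsIntegralClosure (integralClosure A K) P K :=
    { algebraMap_injective := Subtype.val_injective
      isIntegral_iff := fun {x} =>
        ⟨fun h => ⟨⟨x, h.tower_top⟩, rfl⟩, fun ⟨y, hy⟩ => hy ▸ isIntegral_trans _ y.2⟩ }
  have : Module.Finite P (integralClosure A K) :=
    IsIntegralClosure.finite P (FractionRing P) K (integralClosure A K)
  exact .trans (S := P) inferInstance inferInstance

/-- In a domain of finite type over an algebraically closed field of characteristic zero,
if `g ≠ 0` divides the differential of `f`, then the quotients of high powers of some product of
distinct factors `f - c` by the next power of `g` are integral. -/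
theorem exists_isIntegral_pow_eq_of_dvd_D {k A : Type} [Field k] [IsAlgClosed k]
    [CharZero k] [CommRing A] [IsDomain A] [Algebra k A] [Algebra.FiniteType k A] {f g : A}
    (hg : g ≠ 0) {ω : Ω[A⁄k]} (hω : KaehlerDifferential.D k A f = g • ω) :
    ∃ (S : Finset k) (n₀ : ℕ), ∀ n ≥ n₀, ∃ h : FractionRing A, IsIntegral A h ∧
      algebraMap A (FractionRing A) ((∏ c ∈ S, (f - algebraMap k A c)) ^ n) =
        algebraMap A (FractionRing A) (g ^ (n + 1)) * h := by
  let K := FractionRing A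
  let B := integralClosure A K
  have := finiteType_integralClosure_fractionRing k A
  have hinj : Function.Injective (algebraMap A B) :=
    fun x y h => IsFractionRing.injective A K (congrArg Subtype.val h)
  have : IsIntegrallyClosed B := integralClosure.isIntegrallyClosedOfFiniteExtension K
  obtain ⟨S, w, n₀, hw, h, hh⟩ := exists_prod_sub_eq_mul_of_dvd_D (k := k)
    (f := algebraMap A B f) ((map_ne_zero_iff _ hinj).mpr hg)
    (ω := KaehlerDifferential.map k k A B ω) (by
      rw [← KaehlerDifferential.map_D k k A B, hω, map_smul,
        ← algebraMap_smul B g (KaehlerDifferential.map k k A B ω)])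
  refine ⟨S, n₀, fun n hn => ⟨(h * w ^ (n - n₀) : B), (h * w ^ (n - n₀) : B).2, ?_⟩⟩
  have key : algebraMap A B ((∏ c ∈ S, (f - algebraMap k A c)) ^ n) =
      algebraMap A B (g ^ (n + 1)) * (h * w ^ (n - n₀)) := by
    have h1 : algebraMap A B (∏ c ∈ S, (f - algebraMap k A c)) = algebraMap A B g * w := by
      rw [← hw, map_prod]
      refine Finset.prod_congr rfl fun c _ => ?_
      rw [map_sub, ← IsScalarTower.algebraMap_apply]
    obtain ⟨m, rfl⟩ := Nat.exists_eq_add_of_le hn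
    rw [map_pow, h1, map_pow, mul_pow, pow_add w, hh, Nat.add_sub_cancel_left]
    ring
  exact congrArg (algebraMap B K) key

/-- A root of a monic polynomial is bounded by one plus the norms of its coefficients. -/
theorem norm_le_one_add_sum_of_eval_eq_zero {p : Polynomial ℂ} (hp : p.Monic) {z : ℂ}
    (hz : p.eval z = 0) : ‖z‖ ≤ 1 + ∑ i ∈ Finset.range p.natDegree, ‖p.coeff i‖ := by
  refine (NNReal.coe_le_coe.mpr (Polynomial.IsRoot.norm_lt_cauchyBound hp.ne_zero hz).le).trans ?_
  rw [Polynomial.cauchyBound, hp.leadingCoeff, nnnorm_one, div_one, NNReal.coe_add, NNReal.coe_one,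
    add_comm, add_le_add_iff_left]
  simp_rw [← coe_nnnorm, ← NNReal.coe_sum, NNReal.coe_le_coe]
  exact Finset.sup_le fun i hi =>
    Finset.single_le_sum (f := fun i => ‖p.coeff i‖₊) (fun _ _ => zero_le) hi

/-- Pointwise form of `exists_isIntegral_pow_eq_of_dvd_D` on a bounded family of complex points. -/
theorem exists_norm_prod_pow_le_of_dvd_D {A ι : Type} [CommRing A] [IsDomain A] [Algebra ℂ A]
    [Algebra.FiniteType ℂ A] {f g : A} (hg : g ≠ 0) {ω : Ω[A⁄ℂ]}
    (hω : KaehlerDifferential.D ℂ A f = g • ω) {φ : ι → A →ₐ[ℂ] ℂ}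
    (hφ : ∀ a, ∃ M : ℝ, ∀ i, ‖φ i a‖ ≤ M) :
    ∃ (S : Finset ℂ) (n₀ : ℕ), ∀ n ≥ n₀, ∃ M : ℝ, ∀ i, φ i g ≠ 0 →
      ‖∏ c ∈ S, (φ i f - c)‖ ^ n ≤ M * ‖φ i g‖ ^ (n + 1) := by
  obtain ⟨S, n₀, h⟩ := exists_isIntegral_pow_eq_of_dvd_D hg hω
  refine ⟨S, n₀, fun n hn => ?_⟩
  obtain ⟨y, ⟨q, hq, hqy⟩, hy⟩ := h n hn
  choose M hM using hφ
  refine ⟨1 + ∑ i ∈ Finset.range q.natDegree, M (q.coeff i), fun i hi => ?_⟩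
  set P := ∏ c ∈ S, (f - algebraMap ℂ A c) with hPdef
  have hP : φ i P = ∏ c ∈ S, (φ i f - c) := by
    simp [P]
  have h0 : (q.scaleRoots (g ^ (n + 1))).eval (P ^ n) = 0 := by
    apply IsFractionRing.injective A (FractionRing A)
    rw [map_zero, ← Polynomial.eval₂_at_apply, hy]
    rw [Polynomial.scaleRoots_eval₂_mul, hqy, mul_zero]
  have hG : φ i (g ^ (n + 1)) ≠ 0 := by
    rw [map_pow]
    exact pow_ne_zero _ hi
  set u := φ i (P ^ n) / φ i (g ^ (n + 1)) with hu
  have hPu : φ i (P ^ n) = φ i (g ^ (n + 1)) * u := by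
    rw [hu, mul_div_cancel₀ _ hG]
  have hroot : (q.map (φ i).toRingHom).eval u = 0 := by
    have h1 := Polynomial.eval₂_at_apply (p := q.scaleRoots (g ^ (n + 1))) (φ i).toRingHom (P ^ n)
    rw [h0, map_zero] at h1
    have h2 := Polynomial.scaleRoots_eval₂_mul (p := q) (φ i).toRingHom u (g ^ (n + 1))
    rw [show (φ i).toRingHom (g ^ (n + 1)) * u = (φ i).toRingHom (P ^ n) from hPu.symm, h1] at h2
    rw [Polynomial.eval_map]
    exact (mul_eq_zero.mp h2.symm).resolve_left (pow_ne_zero _ hG)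
  have hle := norm_le_one_add_sum_of_eval_eq_zero (hq.map _) hroot
  rw [← norm_pow, ← hP, ← map_pow, hPu, norm_mul, mul_comm, map_pow, norm_pow]
  refine mul_le_mul_of_nonneg_right (hle.trans ?_) (by positivity)
  rw [hq.natDegree_map]
  gcongr with j hj
  rw [Polynomial.coeff_map]
  exact hM _ _

theorem exists_D_algebraMap_eq_smul {k A B J : Type} [CommRing k] [CommRing A] [CommRing B]
    [Algebra k A] [Algebra k B] [Algebra A B] [IsScalarTower k A B] [Fintype J] {f : A} {g : J → A}
    {ω : J → Ω[A⁄k]} (hω : KaehlerDifferential.D k A f = ∑ j, g j • ω j) {b : B} {z : J → B}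
    (hz : ∀ j, algebraMap A B (g j) = b * z j) :
    ∃ ω' : Ω[B⁄k], KaehlerDifferential.D k B (algebraMap A B f) = b • ω' := by
  refine ⟨∑ j, z j • KaehlerDifferential.map k k A B (ω j), ?_⟩
  rw [← KaehlerDifferential.map_D k k A B, hω, map_sum, Finset.smul_sum]
  refine Finset.sum_congr rfl fun j _ => ?_
  rw [map_smul, ← algebraMap_smul B (g j), hz, smul_smul]

/-- If the differential of `f` is a combination of the `g j`, then on a bounded family of complex
points at which `g i` is nonzero and dominates all `g j`, some product of distinct factors `f - c`
satisfies Łojasiewicz inequalities with respect to `g i`. -/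
theorem exists_norm_prod_pow_le_of_D_eq_sum_of_dominating {A ι J : Type} [CommRing A] [IsDomain A]
    [Algebra ℂ A] [Algebra.FiniteType ℂ A] [Fintype J] {f : A} {g : J → A} {ω : J → Ω[A⁄ℂ]}
    (hω : KaehlerDifferential.D ℂ A f = ∑ j, g j • ω j) {φ : ι → A →ₐ[ℂ] ℂ}
    (hφ : ∀ a, ∃ M : ℝ, ∀ x, ‖φ x a‖ ≤ M) (i : J) :
    ∃ (S : Finset ℂ) (n₀ : ℕ), ∀ n ≥ n₀, ∃ M : ℝ, ∀ x, φ x (g i) ≠ 0 →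
      (∀ j, ‖φ x (g j)‖ ≤ ‖φ x (g i)‖) →
      ‖∏ c ∈ S, (φ x f - c)‖ ^ n ≤ M * ‖φ x (g i)‖ ^ (n + 1) := by
  by_cases hi : g i = 0
  · exact ⟨∅, 0, fun _ _ => ⟨0, fun x hx => absurd (by rw [hi, map_zero]) hx⟩⟩
  let L := Localization.Away (g i)
  have hle : Submonoid.powers (g i) ≤ nonZeroDivisors A :=
    powers_le_nonZeroDivisors_of_noZeroDivisors hi
  have : IsDomain L := IsLocalization.isDomain_of_le_nonZeroDivisors _ hle
  have hinj : Function.Injective (algebraMap A L) := IsLocalization.injective L hle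
  let y : J → L := fun j => IsLocalization.Away.invSelf (g i) * algebraMap A L (g j)
  have hy : ∀ j, algebraMap A L (g i) * y j = algebraMap A L (g j) := fun j => by
    rw [← mul_assoc, IsLocalization.Away.mul_invSelf, one_mul]
  let B : Subalgebra A L := Algebra.adjoin A (Set.range y)
  have : Algebra.FiniteType A B :=
    (Subalgebra.fg_iff_finiteType _).mp (Subalgebra.fg_def.mpr ⟨_, Set.finite_range y, rfl⟩)
  have : Algebra.FiniteType ℂ B := .trans (S := A) inferInstance inferInstance
  let ι' := {x : ι // φ x (g i) ≠ 0 ∧ ∀ j, ‖φ x (g j)‖ ≤ ‖φ x (g i)‖}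
  have hunit : ∀ (x : ι') (s : Submonoid.powers (g i)), IsUnit (φ x s) := by
    rintro x ⟨_, n, rfl⟩
    exact isUnit_iff_ne_zero.mpr (by simpa using fun h => absurd h x.2.1)
  let ψ : ι' → L →ₐ[ℂ] ℂ := fun x => IsLocalization.liftAlgHom (hunit x)
  have hψ : ∀ x a, ψ x (algebraMap A L a) = φ x a := fun x a =>
    IsLocalization.lift_eq (g := (φ x : A →+* ℂ)) (hunit x) a
  have hψy : ∀ x j, ‖ψ x (y j)‖ ≤ 1 := fun x j => by
    have h1 := congrArg (ψ x) (hy j)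
    rw [map_mul, hψ, hψ] at h1
    have h2 := x.2.2 j
    rw [← h1, norm_mul] at h2
    exact le_of_mul_le_mul_left (by simpa using h2) (norm_pos_iff.mpr x.2.1)
  have hbd : ∀ b : B, ∃ M : ℝ, ∀ x, ‖((ψ x).comp (B.val.restrictScalars ℂ)) b‖ ≤ M := by
    rintro ⟨b, hb⟩
    change ∃ M : ℝ, ∀ x, ‖ψ x b‖ ≤ M
    induction hb using Algebra.adjoin_induction with
    | mem b hb =>
      obtain ⟨j, rfl⟩ := hb
      exact ⟨1, fun x => hψy x j⟩
    | algebraMap a =>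
      obtain ⟨M, hM⟩ := hφ a
      exact ⟨M, fun x => by rw [hψ]; exact hM x⟩
    | add b c _ _ h1 h2 =>
      obtain ⟨M₁, hM₁⟩ := h1
      obtain ⟨M₂, hM₂⟩ := h2
      exact ⟨M₁ + M₂, fun x => by
        rw [map_add]; exact (norm_add_le _ _).trans (add_le_add (hM₁ x) (hM₂ x))⟩
    | mul b c _ _ h1 h2 =>
      obtain ⟨M₁, hM₁⟩ := h1
      obtain ⟨M₂, hM₂⟩ := h2
      exact ⟨M₁ * M₂, fun x => by
        rw [map_mul, norm_mul]
        exact mul_le_mul (hM₁ x) (hM₂ x) (norm_nonneg _) ((norm_nonneg _).trans (hM₁ x))⟩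
  have hgB : algebraMap A B (g i) ≠ 0 := fun h =>
    hi (hinj ((congrArg Subtype.val h).trans (map_zero _).symm))
  let z : J → B := fun j => ⟨y j, Algebra.subset_adjoin (Set.mem_range_self j)⟩
  obtain ⟨ω', hω'⟩ := exists_D_algebraMap_eq_smul (B := B) hω (b := algebraMap A B (g i)) (z := z)
    fun j => Subtype.ext (hy j).symm
  obtain ⟨S, n₀, h⟩ := exists_norm_prod_pow_le_of_dvd_D hgB hω' hbd
  refine ⟨S, n₀, fun n hn => ?_⟩
  obtain ⟨M, hM⟩ := h n hn
  refine ⟨M, fun x hx hx' => ?_⟩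
  have h1 := hM ⟨x, hx, hx'⟩
  have h2 : ∀ a, ((ψ ⟨x, hx, hx'⟩).comp (B.val.restrictScalars ℂ)) (algebraMap A B a) = φ x a :=
    hψ _
  rw [h2, h2] at h1
  exact h1 hx

/-- An algebraic Łojasiewicz inequality: if the differential of `f` is a combination of the `g j`,
then on every bounded family of complex points some power of a product of distinct factors `f - c`
is bounded by the next power of the largest `g j`. -/
theorem exists_norm_prod_pow_le_of_D_eq_sum {A ι J : Type} [CommRing A] [IsDomain A]
    [Algebra ℂ A] [Algebra.FiniteType ℂ A] [Fintype J] {f : A} {g : J → A} {ω : J → Ω[A⁄ℂ]}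
    (hω : KaehlerDifferential.D ℂ A f = ∑ j, g j • ω j) {φ : ι → A →ₐ[ℂ] ℂ}
    (hφ : ∀ a, ∃ M : ℝ, ∀ x, ‖φ x a‖ ≤ M) :
    ∃ (S : Finset ℂ) (n : ℕ) (M : ℝ), ∀ x, (∃ j, φ x (g j) ≠ 0) →
      ∃ j, ‖∏ c ∈ S, (φ x f - c)‖ ^ n ≤ M * ‖φ x (g j)‖ ^ (n + 1) := by
  classical
  choose S n₀ h using fun i => exists_norm_prod_pow_le_of_D_eq_sum_of_dominating hω hφ i
  let T := Finset.univ.biUnion S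
  let n := Finset.univ.sup n₀
  choose M hM using fun i => h i n (Finset.le_sup (Finset.mem_univ i))
  choose M' hM' using fun i => hφ (∏ c ∈ T \ S i, (f - algebraMap ℂ A c))
  refine ⟨T, n, ∑ i, |M' i| ^ n * |M i|, fun x hx => ?_⟩
  obtain ⟨j₀, hj₀⟩ := hx
  obtain ⟨i, -, hi⟩ := Finset.exists_max_image Finset.univ (fun j => ‖φ x (g j)‖)
    ⟨j₀, Finset.mem_univ _⟩
  have hne : φ x (g i) ≠ 0 :=
    norm_pos_iff.mp ((norm_pos_iff.mpr hj₀).trans_le (hi j₀ (Finset.mem_univ _)))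
  refine ⟨i, ?_⟩
  have h1 := hM i x hne fun j => hi j (Finset.mem_univ _)
  have h2 := hM' i x
  simp only [map_prod, map_sub, AlgHom.commutes, Algebra.algebraMap_self, RingHom.id_apply] at h2
  rw [← Finset.prod_sdiff (Finset.subset_biUnion_of_mem S (Finset.mem_univ i)), norm_mul, mul_pow]
  calc _ ≤ |M' i| ^ n * (|M i| * ‖φ x (g i)‖ ^ (n + 1)) := by
        gcongr
        · exact h2.trans (le_abs_self _)
        · exact h1.trans (by gcongr; exact le_abs_self _)
    _ = (|M' i| ^ n * |M i|) * ‖φ x (g i)‖ ^ (n + 1) := by ring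
    _ ≤ _ := by
        gcongr
        exact Finset.single_le_sum (f := fun i => |M' i| ^ n * |M i|) (fun _ _ => by positivity)
          (Finset.mem_univ i)

/-- The ring homomorphism `r ↦ (r, D r)` to the trivial square-zero extension. -/
def Derivation.toTrivSqZeroExt {k R M : Type*} [CommRing k] [CommRing R] [Algebra k R]
    [AddCommGroup M] [Module R M] [Module k M] [Module Rᵐᵒᵖ M] [IsCentralScalar R M]
    (D : Derivation k R M) : R →+* TrivSqZeroExt R M where
  toFun r := TrivSqZeroExt.inl r + TrivSqZeroExt.inr (D r)
  map_one' := by simp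
  map_mul' a b := by
    ext
    · simp
    · simp only [TrivSqZeroExt.snd_add, TrivSqZeroExt.snd_inl, TrivSqZeroExt.snd_inr,
        TrivSqZeroExt.snd_mul, TrivSqZeroExt.fst_add, TrivSqZeroExt.fst_inl, TrivSqZeroExt.fst_inr,
        D.leibniz, op_smul_eq_smul, zero_add, add_zero]
  map_zero' := by simp
  map_add' a b := by ext <;> simp

@[simp] theorem Derivation.fst_toTrivSqZeroExt {k R M : Type*} [CommRing k] [CommRing R]
    [Algebra k R] [AddCommGroup M] [Module R M] [Module k M] [Module Rᵐᵒᵖ M] [IsCentralScalar R M]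
    (D : Derivation k R M) (r : R) : (D.toTrivSqZeroExt r).fst = r := by
  simp [toTrivSqZeroExt]

@[simp] theorem Derivation.snd_toTrivSqZeroExt {k R M : Type*} [CommRing k] [CommRing R]
    [Algebra k R] [AddCommGroup M] [Module R M] [Module k M] [Module Rᵐᵒᵖ M] [IsCentralScalar R M]
    (D : Derivation k R M) (r : R) : (D.toTrivSqZeroExt r).snd = D r := by
  simp [toTrivSqZeroExt]

/-- The derivative of `tr (P x Q x⁻¹)` for constant matrices `P`, `Q`. -/
theorem Derivation.trace_mul_conj {k R M n : Type*} [CommRing k] [CommRing R] [Algebra k R]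
    [AddCommGroup M] [Module R M] [Module k M] [Fintype n] [DecidableEq n] (D : Derivation k R M)
    {x y P Q : Matrix n n R} (hxy : x * y = 1) (hP : ∀ i j, D (P i j) = 0)
    (hQ : ∀ i j, D (Q i j) = 0) :
    D (trace (P * (x * Q * y))) =
      ∑ i, ∑ j, (x * Q * y * P - P * (x * Q * y)) j i • ∑ l, y l j • D (x i l) := by
  let : Module Rᵐᵒᵖ M := Module.compHom M ((RingHom.id R).fromOpposite mul_comm)
  have : IsCentralScalar R M := ⟨fun _ _ => rfl⟩
  have hyx : y * x = 1 := mul_eq_one_comm.mp hxy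
  let ι : R →+* TrivSqZeroExt R M := TrivSqZeroExt.inlHom R M
  let τ : R →+* TrivSqZeroExt R M := D.toTrivSqZeroExt
  have hι : ∀ r, ι r = TrivSqZeroExt.inl r := fun _ => rfl
  let ξ : n → n → M := fun i j => ∑ l, y l j • D (x i l)
  let e : Matrix n n (TrivSqZeroExt R M) := Matrix.of fun i j => TrivSqZeroExt.inr (ξ i j)
  have he : ∀ B : Matrix n n (TrivSqZeroExt R M), e * B * e = 0 := fun B => by
    ext1 i j
    rw [Matrix.mul_apply]
    refine Finset.sum_eq_zero fun a _ => ?_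
    rw [Matrix.mul_apply, Finset.sum_mul]
    refine Finset.sum_eq_zero fun b _ => ?_
    ext <;> simp [e]
  have hee : e * e = 0 := by simpa using he 1
  have hx : τ.mapMatrix x = (1 + e) * ι.mapMatrix x := by
    rw [add_mul, one_mul]
    ext i j
    · simp [τ, hι, Matrix.mul_apply, e, TrivSqZeroExt.fst_sum]
    · have h1 : ∑ a, x a j • ξ i a = D (x i j) := by
        simp only [ξ, Finset.smul_sum, smul_smul]
        rw [Finset.sum_comm]
        simp only [← Finset.sum_smul, mul_comm (x _ j)]
        have h2 : ∀ l, ∑ a, y l a * x a j = (1 : Matrix n n R) l j := fun l => by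
          rw [← hyx, Matrix.mul_apply]
        simp [h2, Matrix.one_apply]
      simp [τ, hι, Matrix.mul_apply, e, TrivSqZeroExt.snd_sum, h1]
  have hy : τ.mapMatrix y = ι.mapMatrix y * (1 - e) := by
    have h1 : τ.mapMatrix x * τ.mapMatrix y = 1 := by rw [← map_mul, hxy, map_one]
    have h2 : ι.mapMatrix y * (1 - e) * τ.mapMatrix x = 1 := by
      rw [hx, mul_assoc, ← mul_assoc (1 - e), show (1 - e) * (1 + e) = 1 by
        rw [sub_mul, mul_add, mul_add, hee]; simp, one_mul, ← map_mul, hyx, map_one]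
    exact (left_inv_eq_right_inv h2 h1).symm
  have hPm : τ.mapMatrix P = ι.mapMatrix P := by
    ext i j <;> simp [τ, hι, hP]
  have hQm : τ.mapMatrix Q = ι.mapMatrix Q := by
    ext i j <;> simp [τ, hι, hQ]
  have htr : τ (trace (P * (x * Q * y))) =
      ι (trace (P * (x * Q * y))) +
        trace (e * ι.mapMatrix (x * Q * y * P - P * (x * Q * y))) := by
    have h1 : ∀ (ρ : R →+* TrivSqZeroExt R M) (Z : Matrix n n R),
        ρ (trace Z) = trace (ρ.mapMatrix Z) := fun ρ Z => AddMonoidHom.map_trace ρ Z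
    rw [h1, h1]
    simp only [map_mul, map_sub, hx, hy, hPm, hQm]
    set p := ι.mapMatrix P
    set z := ι.mapMatrix x * ι.mapMatrix Q * ι.mapMatrix y with hz
    have h2 : p * ((1 + e) * ι.mapMatrix x * ι.mapMatrix Q * (ι.mapMatrix y * (1 - e))) =
        p * z + p * (e * z) - p * z * e - p * (e * z * e) := by
      rw [hz]
      noncomm_ring
    rw [h2, he, mul_zero, sub_zero, trace_sub, trace_add, mul_sub, trace_sub, trace_mul_comm (p * z),
      trace_mul_comm p (e * z), mul_assoc e z p, add_sub_assoc]
  have h1 := congrArg TrivSqZeroExt.snd htr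
  simp only [τ, hι, Derivation.snd_toTrivSqZeroExt, TrivSqZeroExt.snd_add, TrivSqZeroExt.snd_inl,
    zero_add] at h1
  rw [h1, trace]
  generalize x * Q * y * P - P * (x * Q * y) = K
  simp [Matrix.mul_apply, e, TrivSqZeroExt.snd_sum, hι, ξ]

theorem half_commutator_add_eq_skewPart {N : ℕ} (X C : Matrix (Fin N) (Fin N) ℂ) :
    ((1 : ℂ) / 2) • ((X * Cᴴ - Cᴴ * X) + (Xᴴ * C - C * Xᴴ)) = skewPart (X * Cᴴ - Cᴴ * X) := by
  rw [skewPart, conjTranspose_sub, conjTranspose_mul, conjTranspose_mul, conjTranspose_conjTranspose]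
  congr 1
  abel

theorem half_trace_add_eq_re {N : ℕ} (X C : Matrix (Fin N) (Fin N) ℂ) :
    ((1 : ℂ) / 2) * (trace (Cᴴ * X) + trace (C * Xᴴ)) = (((Cᴴ * X).trace.re : ℝ) : ℂ) := by
  have : trace (C * Xᴴ) = star (trace (Cᴴ * X)) := by
    rw [← trace_conjTranspose, conjTranspose_mul, conjTranspose_conjTranspose, trace_mul_comm]
  rw [this, Complex.re_eq_add_conj, Complex.star_def]
  ring

/-- The Łojasiewicz inequality for `X ↦ Re tr (C† X)` on a unitary orbit. -/
theorem exists_norm_prod_pow_le_norm_skewPart {N : ℕ} (A C : Matrix (Fin N) (Fin N) ℂ) :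
    ∃ (S : Finset ℂ) (n : ℕ) (M : ℝ), 0 ≤ M ∧ ∀ U ∈ unitaryGroup (Fin N) ℂ, ∀ X, X = U * A * Uᴴ →
      skewPart (X * Cᴴ - Cᴴ * X) ≠ 0 →
      ‖∏ c ∈ S, ((((Cᴴ * X).trace.re : ℝ) : ℂ) - c)‖ ^ n ≤
        M * ‖skewPart (X * Cᴴ - Cᴴ * X)‖ ^ (n + 1) := by
  let P := MvPolynomial (Fin N × Fin N) ℂ
  let d : P := det (mvPolynomialX (Fin N) (Fin N) ℂ)
  have hd : d ≠ 0 := det_mvPolynomialX_ne_zero _ _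
  let R := Localization.Away d
  have : IsDomain R := IsLocalization.isDomain_localization
    (powers_le_nonZeroDivisors_of_noZeroDivisors hd)
  have : Algebra.FiniteType P R := IsLocalization.finiteType_of_monoid_fg (.powers d) R
  have : Algebra.FiniteType ℂ R := .trans (S := P) inferInstance inferInstance
  let x : Matrix (Fin N) (Fin N) R := (algebraMap P R).mapMatrix (mvPolynomialX (Fin N) (Fin N) ℂ)
  have hdx : IsUnit x.det := by
    rw [← RingHom.map_det]
    exact IsLocalization.Away.algebraMap_isUnit d
  let c : Matrix (Fin N) (Fin N) ℂ →+* Matrix (Fin N) (Fin N) R := (algebraMap ℂ R).mapMatrix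
  let Y := x * c A * x⁻¹
  let Y' := x * c Aᴴ * x⁻¹
  have hxx : x * x⁻¹ = 1 := mul_nonsing_inv x hdx
  have hc : ∀ Z i j, KaehlerDifferential.D ℂ R (c Z i j) = 0 := fun Z i j =>
    Derivation.map_algebraMap _ _
  let f : R := algebraMap ℂ R (1 / 2) * (trace (c Cᴴ * Y) + trace (c C * Y'))
  let G := algebraMap ℂ R (1 / 2) • ((Y * c Cᴴ - c Cᴴ * Y) + (Y' * c C - c C * Y'))
  have hf : KaehlerDifferential.D ℂ R f = ∑ p : Fin N × Fin N, G p.2 p.1 •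
      ∑ l, x⁻¹ l p.2 • KaehlerDifferential.D ℂ R (x p.1 l) := by
    rw [Derivation.leibniz, Derivation.map_algebraMap, smul_zero, add_zero, map_add,
      Derivation.trace_mul_conj _ hxx (hc _) (hc _), Derivation.trace_mul_conj _ hxx (hc _) (hc _),
      Fintype.sum_prod_type, ← Finset.sum_add_distrib, Finset.smul_sum]
    refine Finset.sum_congr rfl fun i _ => ?_
    rw [← Finset.sum_add_distrib, Finset.smul_sum]
    refine Finset.sum_congr rfl fun j _ => ?_
    rw [← add_smul, smul_smul]
    rfl
  let ev : unitaryGroup (Fin N) ℂ → P →ₐ[ℂ] ℂ := fun U =>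
    MvPolynomial.aeval fun p : Fin N × Fin N => (U : Matrix (Fin N) (Fin N) ℂ) p.1 p.2
  have hev : ∀ U, ev U d = det (U : Matrix (Fin N) (Fin N) ℂ) := fun U => by
    rw [← mvPolynomialX_mapMatrix_aeval ℂ (U : Matrix (Fin N) (Fin N) ℂ)]
    exact AlgHom.map_det _ _
  have hdet : ∀ U, ‖ev U d‖ = 1 := fun U => by
    rw [hev]
    exact CStarRing.norm_of_mem_unitary (det_of_mem_unitary U.2)
  have hunit : ∀ U (s : Submonoid.powers d), IsUnit (ev U s) := by
    rintro U ⟨_, n, rfl⟩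
    refine isUnit_iff_ne_zero.mpr (norm_pos_iff.mp ?_)
    rw [map_pow, norm_pow, hdet, one_pow]
    exact one_pos
  let φ : unitaryGroup (Fin N) ℂ → R →ₐ[ℂ] ℂ := fun U => IsLocalization.liftAlgHom (hunit U)
  have hφP : ∀ U p, φ U (algebraMap P R p) = ev U p := fun U p =>
    IsLocalization.lift_eq (g := (ev U : P →+* ℂ)) (hunit U) p
  have hφx : ∀ U, (φ U).mapMatrix x = U := fun U => by
    ext i j
    exact (hφP U _).trans (MvPolynomial.aeval_X _ _)
  have hφy : ∀ U, (φ U).mapMatrix x⁻¹ = (U : Matrix (Fin N) (Fin N) ℂ)ᴴ := fun U => by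
    have h1 : (φ U).mapMatrix x * (φ U).mapMatrix x⁻¹ = 1 := by rw [← map_mul, hxx, map_one]
    rw [hφx] at h1
    exact (left_inv_eq_right_inv (mem_unitaryGroup_iff'.mp U.2) h1).symm
  have hφc : ∀ U Z, (φ U).mapMatrix (c Z) = Z := fun U Z => by
    ext i j
    simp [c]
  have hbd : ∀ r, ∃ M : ℝ, ∀ U, ‖φ U r‖ ≤ M := fun r => by
    have hp : ∀ p : P, ∃ M : ℝ, ∀ U, ‖ev U p‖ ≤ M := fun p => by
      induction p using MvPolynomial.induction_on with
      | C a => exact ⟨‖a‖, fun U => by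
          rw [show ev U (MvPolynomial.C a) = a from MvPolynomial.aeval_C _ _]⟩
      | add p q h1 h2 =>
        obtain ⟨M₁, hM₁⟩ := h1
        obtain ⟨M₂, hM₂⟩ := h2
        exact ⟨M₁ + M₂, fun U => by
          rw [map_add]; exact (norm_add_le _ _).trans (add_le_add (hM₁ U) (hM₂ U))⟩
      | mul_X p i h1 =>
        obtain ⟨M₁, hM₁⟩ := h1
        refine ⟨M₁ * 1, fun U => ?_⟩
        rw [map_mul, norm_mul]
        refine mul_le_mul (hM₁ U) ?_ (norm_nonneg _) ((norm_nonneg _).trans (hM₁ U))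
        rw [show ev U (MvPolynomial.X i) = _ from MvPolynomial.aeval_X _ _]
        exact entry_norm_bound_of_unitary U.2 i.1 i.2
    obtain ⟨p, s, hs⟩ := IsLocalization.exists_mk'_eq (Submonoid.powers d) r
    obtain ⟨M, hM⟩ := hp p
    refine ⟨M, fun U => ?_⟩
    have h1 : φ U r * φ U (algebraMap P R s) = ev U p := by
      rw [← map_mul, ← hs, IsLocalization.mk'_spec, hφP]
    obtain ⟨_, n, rfl⟩ := s
    have h2 := congrArg norm h1
    rw [hφP, map_pow, norm_mul, norm_pow, hdet, one_pow, mul_one] at h2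
    exact h2.le.trans (hM U)
  obtain ⟨S, n, M, h⟩ := exists_norm_prod_pow_le_of_D_eq_sum hf hbd
  refine ⟨S, n, |M|, abs_nonneg _, fun U hU X hX hS => ?_⟩
  have hY : (φ ⟨U, hU⟩).mapMatrix Y = X := by
    simp only [Y, map_mul, hφx, hφy, hφc, hX]
  have hY' : (φ ⟨U, hU⟩).mapMatrix Y' = Xᴴ := by
    simp only [Y', map_mul, hφx, hφy, hφc, hX, conjTranspose_mul, conjTranspose_conjTranspose,
      mul_assoc]
  have hfX : φ ⟨U, hU⟩ f = (((Cᴴ * X).trace.re : ℝ) : ℂ) := by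
    have htr : ∀ Z W, φ ⟨U, hU⟩ (trace (c Z * W)) = trace (Z * (φ ⟨U, hU⟩).mapMatrix W) :=
      fun Z W => by
        conv_rhs => rw [← hφc ⟨U, hU⟩ Z]
        rw [← map_mul]
        exact AddMonoidHom.map_trace (φ ⟨U, hU⟩) _
    rw [← half_trace_add_eq_re, map_mul, map_add, htr, htr, hY, hY', AlgHom.commutes]
    rfl
  have hGX : (φ ⟨U, hU⟩).mapMatrix G = skewPart (X * Cᴴ - Cᴴ * X) := by
    have hG : (φ ⟨U, hU⟩).mapMatrix ((Y * c Cᴴ - c Cᴴ * Y) + (Y' * c C - c C * Y')) =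
        (X * Cᴴ - Cᴴ * X) + (Xᴴ * C - C * Xᴴ) := by
      have hmul := fun V W : Matrix (Fin N) (Fin N) R => map_mul (φ ⟨U, hU⟩).mapMatrix V W
      rw [map_add, map_sub, map_sub, hmul Y, hmul _ Y, hmul Y', hmul _ Y', hφc, hφc, hY, hY']
    rw [← half_commutator_add_eq_skewPart, ← hG]
    ext i j
    refine (map_mul (φ ⟨U, hU⟩) _ _).trans ?_
    rw [AlgHom.commutes]
    rfl
  have hGe : ∀ i j, φ ⟨U, hU⟩ (G i j) = skewPart (X * Cᴴ - Cᴴ * X) i j := fun i j => by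
    rw [← hGX]
    rfl
  obtain ⟨p, hp⟩ := h ⟨U, hU⟩ (by
    by_contra! hall
    refine hS (Matrix.ext fun i j => ?_)
    rw [← hGe]
    exact hall (j, i))
  rw [hfX, hGe] at hp
  refine hp.trans ?_
  gcongr
  · exact le_abs_self _
  · exact norm_entry_le_entrywise_sup_norm _

theorem Matrix.norm_mul_le_card {l m n : Type*} [Fintype l] [Fintype m] [Fintype n]
    (A : Matrix l m ℂ) (B : Matrix m n ℂ) : ‖A * B‖ ≤ Fintype.card m * (‖A‖ * ‖B‖) := by
  refine (norm_le_iff (by positivity)).mpr fun i j => ?_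
  rw [mul_apply]
  refine (norm_sum_le_of_le (f := fun k => A i k * B k j) (n := fun _ => ‖A‖ * ‖B‖)
    Finset.univ fun k _ => ?_).trans ?_
  · rw [norm_mul]
    exact mul_le_mul (norm_entry_le_entrywise_sup_norm A) (norm_entry_le_entrywise_sup_norm B)
      (norm_nonneg _) (norm_nonneg _)
  · rw [Finset.sum_const, nsmul_eq_mul, Finset.card_univ]

theorem Matrix.norm_commutator_le {n : Type*} [Fintype n] (A B : Matrix n n ℂ) :
    ‖A * B - B * A‖ ≤ 2 * Fintype.card n * ‖B‖ * ‖A‖ := by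
  refine (norm_sub_le _ _).trans ?_
  linarith [norm_mul_le_card A B, norm_mul_le_card B A]

theorem Matrix.hasDerivAt_mul {n : Type*} [Fintype n] [DecidableEq n] {f g : ℝ → Matrix n n ℂ}
    {f' g' : Matrix n n ℂ} {t : ℝ} (hf : HasDerivAt f f' t) (hg : HasDerivAt g g' t) :
    HasDerivAt (fun s => f s * g s) (f' * g t + f t * g') t := by
  let : NormedRing (Matrix n n ℂ) := Matrix.linftyOpNormedRing
  let : NormedAlgebra ℝ (Matrix n n ℂ) := Matrix.linftyOpNormedAlgebra
  exact HasDerivAt.mul hf hg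

theorem exists_hasDerivAt_mem_unitary {R : Type*} [NormedRing R] [NormedAlgebra ℝ R]
    [CompleteSpace R] [StarRing R] [StarModule ℝ R] [ContinuousStar R] {Ω : R} (hΩ : star Ω = -Ω)
    (t : ℝ) :
    ∃ V : ℝ → R, (∀ s, V s ∈ unitary R) ∧ V t = 1 ∧ HasDerivAt V Ω t ∧
      HasDerivAt (fun s => star (V s)) (-Ω) t := by
  let : NormedAlgebra ℚ R := .restrictScalars ℚ ℝ _
  have hd : ∀ Z : R, HasDerivAt (fun s : ℝ => NormedSpace.exp ((s - t) • Z)) Z t := fun Z => by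
    simpa using (hasDerivAt_exp_smul_const (𝕂 := ℝ) Z (t - t)).comp_sub_const t t
  refine ⟨fun s => NormedSpace.exp ((s - t) • Ω), fun s => ?_, by simp, hd Ω, ?_⟩
  · refine NormedSpace.exp_mem_unitary_of_mem_skewAdjoint (skewAdjoint.smul_mem _ ?_)
    exact skewAdjoint.mem_iff.mpr hΩ
  · simpa only [NormedSpace.star_exp, star_smul, star_trivial, hΩ] using hd (-Ω)

theorem Matrix.exists_hasDerivAt_mem_unitaryGroup {n : Type*} [Fintype n] [DecidableEq n]
    {Ω : Matrix n n ℂ} (hΩ : Ωᴴ = -Ω) (t : ℝ) :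
    ∃ V : ℝ → Matrix n n ℂ, (∀ s, V s ∈ unitaryGroup n ℂ) ∧ V t = 1 ∧ HasDerivAt V Ω t ∧
      HasDerivAt (fun s => (V s)ᴴ) (-Ω) t := by
  let := Matrix.linftyOpNormedRing (n := n) (α := ℂ)
  let := Matrix.linftyOpNormedAlgebra (n := n) (R := ℝ) (α := ℂ)
  exact @exists_hasDerivAt_mem_unitary (Matrix n n ℂ) _ _ (FiniteDimensional.complete ℝ _) _ _
    ⟨continuous_id.matrix_conjTranspose⟩ _ hΩ t

theorem Matrix.isCompact_unitaryGroup {n : Type*} [Fintype n] [DecidableEq n] :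
    IsCompact (unitaryGroup n ℂ : Set (Matrix n n ℂ)) := by
  have : ProperSpace (Matrix n n ℂ) := FiniteDimensional.proper ℂ _
  refine Metric.isCompact_of_isClosed_isBounded ?_ ?_
  · have : (unitaryGroup n ℂ : Set (Matrix n n ℂ)) = {U | star U * U = 1 ∧ U * star U = 1} := rfl
    rw [this]
    exact (isClosed_eq (by fun_prop) (by fun_prop)).inter (isClosed_eq (by fun_prop) (by fun_prop))
  · refine isBounded_iff_forall_norm_le.mpr ⟨1, fun U hU => ?_⟩
    exact (norm_le_iff zero_le_one).mpr fun i j => entry_norm_bound_of_unitary hU i j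

/-- A differentiable curve in the direction `[X, Ω]`, with `Ω` skew-Hermitian, stays on the unitary
orbit. -/
theorem exists_mem_unitaryGroup_eq_conj {n : Type*} [Fintype n] [DecidableEq n]
    {X Ω : ℝ → Matrix n n ℂ} {b K : ℝ} (hb : 0 ≤ b)
    (hX : ∀ t ∈ Set.Icc 0 b, HasDerivAt X (X t * Ω t - Ω t * X t) t)
    (hΩ : ∀ t ∈ Set.Icc 0 b, (Ω t)ᴴ = -Ω t) (hK : ∀ t ∈ Set.Icc 0 b, ‖Ω t‖ ≤ K) :
    ∃ U ∈ unitaryGroup n ℂ, X b = U * X 0 * Uᴴ := by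
  let O : Set (Matrix n n ℂ) := (fun U => U * X 0 * Uᴴ) '' unitaryGroup n ℂ
  have hO : IsCompact O := isCompact_unitaryGroup.image (by fun_prop)
  have h0 : X 0 ∈ O := ⟨1, one_mem _, by simp⟩
  have hne : O.Nonempty := ⟨_, h0⟩
  have hmain : ∀ t ∈ Set.Ico 0 b, ∀ r, 2 * Fintype.card n * K * Metric.infDist (X t) O < r →
      ∃ᶠ z in 𝓝[>] t, (z - t)⁻¹ * (Metric.infDist (X z) O - Metric.infDist (X t) O) < r := by
    intro t ht r hr
    obtain ⟨Y, ⟨U, hU, hUY⟩, hY⟩ := hO.exists_infDist_eq_dist hne (X t)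
    have ht' := Set.Ico_subset_Icc_self ht
    obtain ⟨V, hV, hVt, hVd, hVd'⟩ := exists_hasDerivAt_mem_unitaryGroup (hΩ t ht') t
    let Z : ℝ → Matrix n n ℂ := fun s => X s - (V s)ᴴ * Y * V s
    have hZt : Z t = X t - Y := by simp [Z, hVt]
    have hZ : HasDerivAt Z (Z t * Ω t - Ω t * Z t) t := by
      have h := (hX t ht').sub
        (hasDerivAt_mul (hasDerivAt_mul hVd' (hasDerivAt_const t Y)) hVd)
      have heq : Z t * Ω t - Ω t * Z t = X t * Ω t - Ω t * X t -
          ((-Ω t * Y + (V t)ᴴ * 0) * V t + (V t)ᴴ * Y * Ω t) := by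
        rw [hZt, hVt, conjTranspose_one]
        noncomm_ring
      rw [heq]
      exact h
    have hZr : ‖Z t * Ω t - Ω t * Z t‖ < r := by
      refine ((norm_commutator_le _ _).trans ?_).trans_lt hr
      rw [hY, dist_eq_norm, ← hZt]
      gcongr
      exact hK t ht'
    refine (hZ.hasDerivWithinAt.liminf_right_slope_norm_le hZr).mp
      (eventually_mem_nhdsWithin.mono fun z hz hzr => lt_of_le_of_lt ?_ hzr)
    have hzt : 0 < z - t := sub_pos.mpr hz
    gcongr
    · refine (Metric.infDist_le_dist_of_mem (y := (V z)ᴴ * Y * V z) ?_).trans (dist_eq_norm _ _).le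
      refine ⟨(V z)ᴴ * U, mul_mem (Unitary.star_mem (hV z)) hU, ?_⟩
      simp only [← hUY, conjTranspose_mul, conjTranspose_conjTranspose, mul_assoc]
    · rw [hY, dist_eq_norm, ← hZt]
  have hcont : ContinuousOn (fun t => Metric.infDist (X t) O) (Set.Icc 0 b) := fun t ht =>
    ((Metric.continuous_infDist_pt O).continuousAt.comp (hX t ht).continuousAt).continuousWithinAt
  have h := le_gronwallBound_of_liminf_deriv_right_le hcont hmain
    (Metric.infDist_zero_of_mem h0).le (ε := 0) (fun t _ => (add_zero _).ge) b ⟨hb, le_rfl⟩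
  rw [gronwallBound_ε0_δ0] at h
  obtain ⟨U, hU, hUX⟩ := (hO.isClosed.mem_iff_infDist_zero hne).mpr
    (h.antisymm Metric.infDist_nonneg)
  exact ⟨U, hU, hUX.symm⟩

/-- A curve whose speed is bounded by the derivative of a convergent function converges. -/
theorem exists_tendsto_of_norm_deriv_le {E : Type*} [NormedAddCommGroup E] [NormedSpace ℝ E]
    [CompleteSpace E] {x x' : ℝ → E} {ψ ψ' : ℝ → ℝ} {T l : ℝ}
    (hx : ∀ t, T ≤ t → HasDerivAt x (x' t) t) (hψ : ∀ t, T ≤ t → HasDerivAt ψ (ψ' t) t)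
    (hle : ∀ t, T ≤ t → ‖x' t‖ ≤ ψ' t) (hl : Tendsto ψ atTop (𝓝 l)) :
    ∃ y, Tendsto x atTop (𝓝 y) := by
  have key : ∀ s t, T ≤ s → s ≤ t → ‖x t - x s‖ ≤ ψ t - ψ s := fun s t hs hst => by
    refine image_norm_le_of_norm_deriv_right_le_deriv_boundary' (f := fun r => x r - x s)
      (f' := x') (B := fun r => ψ r - ψ s) (B' := ψ') (a := s) (b := t) ?_ ?_ (by simp) ?_ ?_ ?_
      ⟨hst, le_rfl⟩
    · exact fun r hr => ((hx r (hs.trans hr.1)).sub_const _).continuousAt.continuousWithinAt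
    · exact fun r hr => ((hx r (hs.trans hr.1)).sub_const _).hasDerivWithinAt
    · exact fun r hr => ((hψ r (hs.trans hr.1)).sub_const _).continuousAt.continuousWithinAt
    · exact fun r hr => ((hψ r (hs.trans hr.1)).sub_const _).hasDerivWithinAt
    · exact fun r hr => hle r (hs.trans hr.1)
  refine cauchySeq_tendsto_of_complete (Metric.cauchySeq_iff'.mpr fun ε hε => ?_)
  obtain ⟨S, hS⟩ := Metric.cauchySeq_iff.mp hl.cauchySeq ε hε
  refine ⟨max S T, fun t ht => ?_⟩
  rw [dist_eq_norm]
  refine (key _ _ (le_max_right _ _) ht).trans_lt ((le_abs_self _).trans_lt ?_)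
  exact hS t ((le_max_left _ _).trans ht) _ (le_max_left _ _)

/-- A curve of speed `O(σ)` along which a bounded function `f` increases at rate at least `σ²`
converges if `f` and `σ` satisfy a Łojasiewicz inequality. -/
theorem exists_tendsto_of_lojasiewicz {E : Type*} [NormedAddCommGroup E] [NormedSpace ℝ E]
    [CompleteSpace E] {x x' : ℝ → E} {f f' σ : ℝ → ℝ} {K M B : ℝ} {S : Finset ℂ} {n : ℕ}
    (hx : ∀ t, 0 ≤ t → HasDerivAt x (x' t) t) (hf : ∀ t, 0 ≤ t → HasDerivAt f (f' t) t)
    (hσ : ∀ t, 0 ≤ σ t) (hxσ : ∀ t, 0 ≤ t → ‖x' t‖ ≤ K * σ t)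
    (hfσ : ∀ t, 0 ≤ t → σ t ^ 2 ≤ f' t) (hB : ∀ t, 0 ≤ t → f t ≤ B) (hM : 0 ≤ M)
    (hS : ∀ t, 0 ≤ t → σ t ≠ 0 → ‖∏ c ∈ S, ((f t : ℂ) - c)‖ ^ n ≤ M * σ t ^ (n + 1)) :
    ∃ y, Tendsto x atTop (𝓝 y) := by
  have hmono : MonotoneOn f (Set.Ici 0) := by
    refine monotoneOn_of_hasDerivWithinAt_nonneg (f' := f') (convex_Ici 0)
      (fun t ht => (hf t ht).continuousAt.continuousWithinAt) (fun t ht => ?_) fun t ht => ?_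
    · exact (hf t (interior_subset ht)).hasDerivWithinAt
    · exact (sq_nonneg _).trans (hfσ t (interior_subset ht))
  obtain ⟨a, ha⟩ : ∃ a, Tendsto f atTop (𝓝 a) := by
    have h : Monotone fun t => f (max t 0) := fun s t hst =>
      hmono (le_max_right s 0) (le_max_right t 0) (max_le_max_right 0 hst)
    refine ⟨_, (tendsto_atTop_ciSup h ⟨B, ?_⟩).congr' ?_⟩
    · rintro _ ⟨t, rfl⟩
      exact hB _ (le_max_right _ _)
    · filter_upwards [eventually_ge_atTop 0] with t ht
      rw [max_eq_left ht]
  have hfa : ∀ t, 0 ≤ t → f t ≤ a := fun t ht => ge_of_tendsto ha <| by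
    filter_upwards [eventually_ge_atTop t] with s hs
    exact hmono ht (ht.trans hs) hs
  by_cases hE : ∃ T, 0 ≤ T ∧ f T = a
  · obtain ⟨T, hT, hTa⟩ := hE
    have hconst : ∀ t, T ≤ t → f t = a := fun t ht =>
      (hfa t (hT.trans ht)).antisymm (hTa ▸ hmono hT (hT.trans ht) ht)
    have hσ0 : ∀ t, T + 1 ≤ t → σ t = 0 := fun t ht => by
      have ht0 : 0 ≤ t := by linarith
      have h : HasDerivAt f 0 t := (hasDerivAt_const t a).congr_of_eventuallyEq <| by
        filter_upwards [eventually_gt_nhds (show T < t by linarith)] with s hs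
        exact hconst s hs.le
      have := hfσ t ht0
      rw [(hf t ht0).unique h] at this
      exact pow_eq_zero_iff two_ne_zero |>.mp (this.antisymm (sq_nonneg _))
    refine exists_tendsto_of_norm_deriv_le (T := T + 1) (fun t ht => hx t (by linarith))
      (fun t _ => hasDerivAt_const t (0 : ℝ)) (fun t ht => ?_) tendsto_const_nhds
    simpa [hσ0 t ht] using hxσ t (by linarith)
  · push Not at hE
    have hE : ∀ t, 0 ≤ t → 0 < a - f t := fun t ht => sub_pos.mpr ((hfa t ht).lt_of_ne (hE t ht))
    have hfC : Tendsto (fun t => ((f t : ℝ) : ℂ)) atTop (𝓝 (a : ℂ)) :=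
      (Complex.continuous_ofReal.tendsto a).comp ha
    obtain ⟨δ, hδ, hδS⟩ : ∃ δ > 0, ∀ᶠ t in atTop,
        δ * (a - f t) ≤ ‖∏ c ∈ S, ((f t : ℂ) - c)‖ := by
      have hlim : Tendsto (fun t => ‖∏ c ∈ S.erase (a : ℂ), ((f t : ℂ) - c)‖) atTop
          (𝓝 ‖∏ c ∈ S.erase (a : ℂ), ((a : ℂ) - c)‖) :=
        (tendsto_finsetProd _ fun c _ => hfC.sub_const c).norm
      have hpos : 0 < ‖∏ c ∈ S.erase (a : ℂ), ((a : ℂ) - c)‖ := by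
        refine norm_pos_iff.mpr (Finset.prod_ne_zero_iff.mpr fun c hc => ?_)
        exact sub_ne_zero.mpr (Finset.ne_of_mem_erase hc).symm
      refine ⟨_, half_pos hpos, ?_⟩
      filter_upwards [hlim.eventually_const_le (half_lt_self hpos), eventually_ge_atTop 0,
        ha.eventually_const_le (show a - 1 < a by linarith)] with t h1 h2 h3
      by_cases haS : (a : ℂ) ∈ S
      · rw [← Finset.prod_erase_mul _ _ haS, norm_mul]
        refine mul_le_mul h1 ?_ (hE t h2).le (norm_nonneg _)
        rw [← Complex.ofReal_sub, Complex.norm_real, norm_sub_rev]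
        exact le_abs_self _
      · rw [Finset.erase_eq_of_notMem haS] at h1 ⊢
        refine le_trans ?_ h1
        exact mul_le_of_le_one_right (half_pos (by rwa [Finset.erase_eq_of_notMem haS] at hpos)).le
          (by linarith)
    obtain ⟨T, hT⟩ := eventually_atTop.mp hδS
    set p : ℝ := ((n + 1 : ℕ) : ℝ)⁻¹ with hp
    have hp0 : 0 < p := by positivity
    have hnp : 1 - p = n * p := by rw [hp]; push_cast; field_simp; ring
    set D : ℝ := (M * (δ ^ n)⁻¹) ^ p with hD
    have hD0 : 0 ≤ D := by positivity
    have hloj : ∀ t, max T 0 ≤ t → σ t ≤ D * (a - f t) ^ (p - 1) * f' t := fun t ht => by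
      have ht0 : 0 ≤ t := (le_max_right _ _).trans ht
      have he := hE t ht0
      rcases eq_or_ne (σ t) 0 with h0 | h0
      · have := (sq_nonneg _).trans (hfσ t ht0)
        rw [h0]
        positivity
      have h1 : (δ * (a - f t)) ^ n ≤ M * σ t ^ (n + 1) :=
        (pow_le_pow_left₀ (by positivity) (hT t ((le_max_left _ _).trans ht)) n).trans (hS t ht0 h0)
      have h2 : (a - f t) ^ n ≤ M * (δ ^ n)⁻¹ * σ t ^ (n + 1) := by
        rw [mul_pow] at h1
        calc (a - f t) ^ n = (δ ^ n)⁻¹ * (δ ^ n * (a - f t) ^ n) := by field_simp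
          _ ≤ (δ ^ n)⁻¹ * (M * σ t ^ (n + 1)) := by gcongr
          _ = _ := by ring
      have h3 : (a - f t) ^ (1 - p) ≤ D * σ t := by
        calc (a - f t) ^ (1 - p) = ((a - f t) ^ n) ^ p := by
              rw [hnp, Real.rpow_mul he.le, Real.rpow_natCast]
          _ ≤ (M * (δ ^ n)⁻¹ * σ t ^ (n + 1)) ^ p := Real.rpow_le_rpow (by positivity) h2 hp0.le
          _ = D * σ t := by
              rw [Real.mul_rpow (by positivity) (pow_nonneg (hσ t) _), hp,
                Real.pow_rpow_inv_natCast (hσ t) n.succ_ne_zero]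
      have h4 : (a - f t) ^ (p - 1) * (a - f t) ^ (1 - p) = 1 := by
        rw [← Real.rpow_add he]
        simp
      calc σ t = (a - f t) ^ (p - 1) * (a - f t) ^ (1 - p) * σ t := by rw [h4, one_mul]
        _ ≤ (a - f t) ^ (p - 1) * (D * σ t) * σ t := by
            have := hσ t
            gcongr
        _ = D * (a - f t) ^ (p - 1) * σ t ^ 2 := by ring
        _ ≤ D * (a - f t) ^ (p - 1) * f' t := by
            gcongr
            exact hfσ t ht0
    refine exists_tendsto_of_norm_deriv_le (T := max T 0) (x' := x')
      (ψ := fun t => -(|K| * D * p⁻¹) * (a - f t) ^ p)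
      (ψ' := fun t => |K| * (D * (a - f t) ^ (p - 1) * f' t))
      (l := -(|K| * D * p⁻¹) * (a - a) ^ p)
      (fun t ht => hx t ((le_max_right _ _).trans ht)) (fun t ht => ?_) (fun t ht => ?_) ?_
    · have ht0 : 0 ≤ t := (le_max_right _ _).trans ht
      have h := (((hf t ht0).const_sub a).rpow_const (p := p) (.inl (hE t ht0).ne')).const_mul
        (-(|K| * D * p⁻¹))
      refine h.congr_deriv ?_
      field_simp
    · refine (hxσ t ((le_max_right _ _).trans ht)).trans ?_
      exact (mul_le_mul_of_nonneg_right (le_abs_self K) (hσ t)).trans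
        (mul_le_mul_of_nonneg_left (hloj t ht) (abs_nonneg K))
    · exact ((ha.const_sub a).rpow_const (.inr hp0.le)).const_mul _

theorem conjTranspose_skewPart {N : ℕ} (M : Matrix (Fin N) (Fin N) ℂ) :
    (skewPart M)ᴴ = -skewPart M := by
  simp [skewPart, ← smul_neg]

theorem continuous_skewPart {N : ℕ} : Continuous (skewPart (N := N)) := by
  unfold skewPart
  fun_prop

theorem re_trace_mul_skewPart {N : ℕ} (M : Matrix (Fin N) (Fin N) ℂ) :
    -(trace (M * skewPart M)).re = (trace ((skewPart M)ᴴ * skewPart M)).re := by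
  have h : trace (Mᴴ * skewPart M) = -star (trace (M * skewPart M)) := by
    rw [← trace_conjTranspose, conjTranspose_mul, conjTranspose_skewPart, neg_mul, trace_neg,
      neg_neg, trace_mul_comm]
  have h2 : trace (skewPart M * skewPart M) =
      (1 / 2 : ℂ) * (trace (M * skewPart M) - trace (Mᴴ * skewPart M)) := by
    conv_lhs => rw [show skewPart M * skewPart M = ((1 / 2 : ℂ) • (M - Mᴴ)) * skewPart M from rfl]
    rw [smul_mul_assoc, trace_smul, sub_mul, trace_sub, smul_eq_mul]
  rw [conjTranspose_skewPart, neg_mul, trace_neg, h2, h, Complex.neg_re]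
  simp
  ring

theorem Matrix.sq_norm_le_re_trace_conjTranspose_mul_self {n : Type*} [Fintype n]
    (M : Matrix n n ℂ) : ‖M‖ ^ 2 ≤ (trace (Mᴴ * M)).re := by
  have h : (trace (Mᴴ * M)).re = ∑ j, ∑ i, ‖M i j‖ ^ 2 := by
    simp only [trace, diag_apply, mul_apply, conjTranspose_apply, Complex.re_sum]
    refine Finset.sum_congr rfl fun j _ => Finset.sum_congr rfl fun i _ => ?_
    rw [Complex.star_def, ← Complex.normSq_eq_conj_mul_self, Complex.ofReal_re, Complex.sq_norm]
  have h0 : 0 ≤ (trace (Mᴴ * M)).re := by rw [h]; positivity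
  rw [← Real.le_sqrt (norm_nonneg _) h0, norm_le_iff (Real.sqrt_nonneg _)]
  refine fun i j => Real.le_sqrt_of_sq_le ?_
  rw [h]
  refine (Finset.single_le_sum (f := fun i => ‖M i j‖ ^ 2) (fun _ _ => by positivity)
    (Finset.mem_univ i)).trans ?_
  exact Finset.single_le_sum (f := fun j => ∑ i, ‖M i j‖ ^ 2) (fun _ _ => by positivity)
    (Finset.mem_univ j)

theorem hasDerivAt_re_trace_mul {N : ℕ} (C : Matrix (Fin N) (Fin N) ℂ)
    {X : ℝ → Matrix (Fin N) (Fin N) ℂ} {X' : Matrix (Fin N) (Fin N) ℂ} {t : ℝ}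
    (hX : HasDerivAt X X' t) :
    HasDerivAt (fun s => ((C * X s).trace).re) ((C * X').trace).re t := by
  let L : Matrix (Fin N) (Fin N) ℂ →ₗ[ℝ] ℝ :=
    { toFun := fun Z => ((C * Z).trace).re
      map_add' := fun Y Z => by rw [mul_add, trace_add, Complex.add_re]
      map_smul' := fun r Z => by
        rw [mul_smul_comm, trace_smul, Complex.smul_re, RingHom.id_apply] }
  exact (LinearMap.toContinuousLinearMap L).hasFDerivAt.comp_hasDerivAt t hX

theorem re_trace_mul_commutator_skewPart {N : ℕ} (X C : Matrix (Fin N) (Fin N) ℂ) :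
    (trace (Cᴴ * (X * skewPart (X * Cᴴ - Cᴴ * X) - skewPart (X * Cᴴ - Cᴴ * X) * X))).re =
      (trace ((skewPart (X * Cᴴ - Cᴴ * X))ᴴ * skewPart (X * Cᴴ - Cᴴ * X))).re := by
  rw [← re_trace_mul_skewPart, ← Complex.neg_re]
  set Ω := skewPart (X * Cᴴ - Cᴴ * X)
  congr 1
  rw [mul_sub, trace_sub, sub_mul, trace_sub, trace_mul_cycle' Cᴴ Ω X, neg_sub, mul_assoc,
    mul_assoc]

theorem eq_zero_of_tendsto_of_sq_norm_le_deriv {E : Type*} [NormedAddCommGroup E] {y : ℝ → E}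
    {l : E} {f f' : ℝ → ℝ} {B : ℝ} (hf : ∀ t, 0 ≤ t → HasDerivAt f (f' t) t)
    (hy : ∀ t, 0 ≤ t → ‖y t‖ ^ 2 ≤ f' t) (hB : ∀ t, 0 ≤ t → f t ≤ B)
    (hl : Tendsto y atTop (𝓝 l)) : l = 0 := by
  by_contra h0
  have hpos : 0 < ‖l‖ ^ 2 := by positivity
  obtain ⟨T, hT⟩ := eventually_atTop.mp
    ((hl.norm.pow 2).eventually_const_le (half_lt_self hpos))
  set ε := ‖l‖ ^ 2 / 2 with hε
  have hε0 : 0 < ε := half_pos hpos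
  have hmono : MonotoneOn (fun t => f t - ε * t) (Set.Ici (max T 0)) := by
    have hd : ∀ t ∈ Set.Ici (max T 0), HasDerivAt (fun t => f t - ε * t) (f' t - ε * 1) t :=
      fun t ht => (hf t ((le_max_right _ _).trans ht)).sub ((hasDerivAt_id t).const_mul ε)
    refine monotoneOn_of_hasDerivWithinAt_nonneg (f' := fun t => f' t - ε * 1) (convex_Ici _)
      (fun t ht => (hd t ht).continuousAt.continuousWithinAt)
      (fun t ht => (hd t (interior_subset ht)).hasDerivWithinAt) fun t ht => ?_
    have ht' : max T 0 ≤ t := interior_subset ht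
    linarith [hT t ((le_max_left _ _).trans ht'), hy t ((le_max_right _ _).trans ht')]
  have hlim : Tendsto (fun t => f (max T 0) - ε * max T 0 + ε * t) atTop atTop :=
    tendsto_atTop_add_const_left _ _ (tendsto_id.const_mul_atTop hε0)
  obtain ⟨t, ht, ht2⟩ := ((hlim.eventually_gt_atTop B).and (eventually_ge_atTop (max T 0))).exists
  have h1 := hmono (Set.mem_Ici.mpr le_rfl) ht2 ht2
  have h2 := hB t ((le_max_right _ _).trans ht2)
  simp only at h1
  linarith

/-- Any solution of the double-bracket flow `X' = [X, ([X,C†])_S]` with `X(0) = A` is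
isospectral (stays on the unitary orbit of `A`), increases `t ↦ Re tr(C† X)` monotonically,
and converges as `t → ∞` to a matrix `X∞` with `([X∞, C†])_S = 0`. -/
theorem stmt4 (N : ℕ) (hN : 1 ≤ N) (A C : Matrix (Fin N) (Fin N) ℂ)
    (X : ℝ → Matrix (Fin N) (Fin N) ℂ) (hX0 : X 0 = A)
    (hode : ∀ t : ℝ, 0 ≤ t →
      HasDerivAt X
        (X t * skewPart (X t * Cᴴ - Cᴴ * X t) - skewPart (X t * Cᴴ - Cᴴ * X t) * X t) t) :
    (∀ t : ℝ, 0 ≤ t → ∃ U ∈ Matrix.unitaryGroup (Fin N) ℂ, X t = U * A * Uᴴ) ∧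
    MonotoneOn (fun t : ℝ => ((Cᴴ * X t).trace).re) (Set.Ici (0 : ℝ)) ∧
    ∃ Xlim : Matrix (Fin N) (Fin N) ℂ,
      Tendsto X atTop (𝓝 Xlim) ∧ skewPart (Xlim * Cᴴ - Cᴴ * Xlim) = 0 := by
  let G : Matrix (Fin N) (Fin N) ℂ → Matrix (Fin N) (Fin N) ℂ :=
    fun Z => skewPart (Z * Cᴴ - Cᴴ * Z)
  have hG : Continuous G := continuous_skewPart.comp (by fun_prop)
  have hcont : ContinuousOn X (Set.Ici 0) := fun t ht => (hode t ht).continuousAt.continuousWithinAt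
  have horbit : ∀ t : ℝ, 0 ≤ t → ∃ U ∈ unitaryGroup (Fin N) ℂ, X t = U * A * Uᴴ := fun t ht => by
    obtain ⟨K, hK⟩ := isCompact_Icc.exists_bound_of_continuousOn (f := fun s => G (X s))
      (hG.comp_continuousOn (hcont.mono (Set.Icc_subset_Ici_self : Set.Icc 0 t ⊆ _)))
    rw [← hX0]
    exact exists_mem_unitaryGroup_eq_conj (Ω := fun s => G (X s)) ht (fun s hs => hode s hs.1)
      (fun s _ => conjTranspose_skewPart _) hK
  have hbdd : ∀ F : Matrix (Fin N) (Fin N) ℂ → ℝ, Continuous F →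
      ∃ B, ∀ t, 0 ≤ t → F (X t) ≤ B := fun F hF => by
    obtain ⟨B, hB⟩ := isCompact_unitaryGroup.exists_bound_of_continuousOn
      (f := fun U : Matrix (Fin N) (Fin N) ℂ => F (U * A * Uᴴ))
      (hF.comp (by fun_prop)).continuousOn
    refine ⟨B, fun t ht => ?_⟩
    obtain ⟨U, hU, hUX⟩ := horbit t ht
    rw [hUX]
    exact (le_abs_self _).trans (hB U hU)
  obtain ⟨B, hB⟩ := hbdd (fun Z => ((Cᴴ * Z).trace).re)
    (Complex.continuous_re.comp (Continuous.matrix_trace (by fun_prop)))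
  obtain ⟨K, hK⟩ := hbdd (fun Z => ‖Z‖) continuous_norm
  have hf : ∀ t, 0 ≤ t → HasDerivAt (fun t : ℝ => ((Cᴴ * X t).trace).re)
      (trace ((G (X t))ᴴ * G (X t))).re t := fun t ht => by
    rw [← re_trace_mul_commutator_skewPart]
    exact hasDerivAt_re_trace_mul Cᴴ (hode t ht)
  have hfσ : ∀ t, 0 ≤ t → ‖G (X t)‖ ^ 2 ≤ (trace ((G (X t))ᴴ * G (X t))).re := fun t _ =>
    sq_norm_le_re_trace_conjTranspose_mul_self _
  obtain ⟨S, n, M, hM, hS⟩ := exists_norm_prod_pow_le_norm_skewPart A C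
  refine ⟨horbit, ?_, ?_⟩
  · refine monotoneOn_of_hasDerivWithinAt_nonneg (convex_Ici 0)
      (fun t ht => (hf t ht).continuousAt.continuousWithinAt)
      (fun t ht => (hf t (interior_subset ht)).hasDerivWithinAt) fun t ht => ?_
    exact (sq_nonneg _).trans (hfσ t (interior_subset ht))
  · have : CompleteSpace (Matrix (Fin N) (Fin N) ℂ) := FiniteDimensional.complete ℝ _
    obtain ⟨Y, hY⟩ := exists_tendsto_of_lojasiewicz (σ := fun t => ‖G (X t)‖)
      (K := 2 * N * K) hode hf (fun t => norm_nonneg _) (fun t ht => by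
        rw [← norm_neg, neg_sub]
        refine (norm_commutator_le _ _).trans ?_
        rw [Fintype.card_fin]
        gcongr
        exact hK t ht) hfσ hB hM (fun t ht hσ => by
        obtain ⟨U, hU, hUX⟩ := horbit t ht
        exact hS U hU (X t) hUX (norm_ne_zero_iff.mp hσ))
    exact ⟨Y, hY, eq_zero_of_tendsto_of_sq_norm_le_deriv hf hfσ hB ((hG.tendsto Y).comp hY)⟩
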